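/- arXiv:2411.06940 — 2 statements merged into one kernel-verified Lean document; each statement's English description precedes it below -/
import Mathlib

section
/- Let Ω ⊂ ℝ² be a bounded C²-regular domain, let x₀ ∈ ∂Ω, let 0 < ρ < r_Ω, and let φ ∈ C₀(B_ρ(x₀) ∩ ∂Ω; [0,1]) be not identically zero. Then there exists an independent constant C such that for all x ∈ B_ρ(x₀) ∩ ∂Ω and all g ∈ C¹(∂Ω): |g(x) − (∫_{∂Ω} φ dH¹)^{−1} ∫_{∂Ω} φ g dH¹| ≤ C ρ^{1/2} ‖∂_τ g‖_{L²(∂Ω)}. -/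
open MeasureTheory Metric Set Filter
open scoped RealInnerProductSpace ENNReal Topology NNReal

noncomputable section

abbrev E2 : Type := EuclideanSpace ℝ (Fin 2)

namespace StokesPaper

/-- The `i`-th standard basis vector of `ℝ²`. -/
def e (i : Fin 2) : E2 := EuclideanSpace.single i (1 : ℝ)

/-- Rotation by +90°; produces the right-handed unit tangent `τ = (-ν₂, ν₁)`
from the outer normal `ν`. -/
def rot (v : E2) : E2 := ⟪v, e 0⟫ • e 1 - ⟪v, e 1⟫ • e 0

/-- The uniform ball condition (UBC) with radius `r`: at every boundary point there are
an open interior ball and an open exterior ball of radius `r` whose boundary spheres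
meet exactly at that point. -/
def IsUBCWith (Ω : Set E2) (r : ℝ) : Prop :=
  0 < r ∧ ∀ x ∈ frontier Ω, ∃ cIn cOut : E2,
    ball cIn r ⊆ Ω ∧ ball cOut r ⊆ Ωᶜ ∧ sphere cIn r ∩ sphere cOut r = {x}

/-- A UBC domain: a bounded domain satisfying the UBC for some radius. -/
def IsUBCDomain (Ω : Set E2) : Prop :=
  IsOpen Ω ∧ IsConnected Ω ∧ Bornology.IsBounded Ω ∧ ∃ r : ℝ, IsUBCWith Ω r

/-- The maximal UBC radius `r_Ω`. -/
def ubcRadius (Ω : Set E2) : ℝ := sSup {r : ℝ | IsUBCWith Ω r}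

/-- The perimeter `P(Ω) = H¹(∂Ω)`. -/
def perim (Ω : Set E2) : ℝ := (μH[1] (frontier Ω)).toReal

/-- The area `|Ω|`. -/
def area (Ω : Set E2) : ℝ := (volume Ω).toReal

/-- Boundary integral with respect to the 1-dimensional Hausdorff measure. -/
def bInt (Ω : Set E2) (f : E2 → ℝ) : ℝ := ∫ x in frontier Ω, f x ∂μH[1]

open Classical in
/-- The signed distance function `d_Ω` (negative inside `Ω`). -/
def sdist (Ω : Set E2) (x : E2) : ℝ :=
  if x ∈ Ω then -(infDist x (frontier Ω)) else infDist x Ω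

/-- The tubular neighborhood `N_r(∂Ω)`. -/
def tubNbhd (Ω : Set E2) (r : ℝ) : Set E2 := {x : E2 | infDist x (frontier Ω) < r}

/-- Pointwise vector Laplacian. -/
def vLap (u : E2 → E2) (x : E2) : E2 :=
  ∑ i : Fin 2, fderiv ℝ (fderiv ℝ u) x (e i) (e i)

/-- Pointwise gradient of a scalar function. -/
def gradv (f : E2 → ℝ) (x : E2) : E2 := ∑ i : Fin 2, fderiv ℝ f x (e i) • e i

/-- Pointwise divergence of a vector field. -/
def divg (u : E2 → E2) (x : E2) : ℝ := ∑ i : Fin 2, ⟪fderiv ℝ u x (e i), e i⟫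

/-- The entry `(∇u)_{ij} = ∂_j u_i` of the gradient matrix. -/
def gradEntry (u : E2 → E2) (x : E2) (i j : Fin 2) : ℝ := ⟪fderiv ℝ u x (e j), e i⟫

/-- The entry of the symmetric gradient `∇_sym u = (∇u + (∇u)ᵀ)/2`. -/
def symGradEntry (u : E2 → E2) (x : E2) (i j : Fin 2) : ℝ :=
  (gradEntry u x i j + gradEntry u x j i) / 2

/-- The symmetric gradient applied to a vector. -/
def symGradApp (u : E2 → E2) (x v : E2) : E2 :=
  ∑ i : Fin 2, (∑ j : Fin 2, symGradEntry u x i j * ⟪v, e j⟫) • e i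

/-- Squared Frobenius norm `|∇u|²`. -/
def gradNormSq (u : E2 → E2) (x : E2) : ℝ :=
  ∑ i : Fin 2, ∑ j : Fin 2, (gradEntry u x i j)^2

/-- Squared Frobenius norm `|∇_sym u|²`. -/
def symGradNormSq (u : E2 → E2) (x : E2) : ℝ :=
  ∑ i : Fin 2, ∑ j : Fin 2, (symGradEntry u x i j)^2

/-- `ν` is the outer unit normal of `Ω` at the boundary point `x`, characterized via the
interior and exterior tangent balls of the uniform ball condition. -/
def IsOuterNormalAt (Ω : Set E2) (x ν : E2) : Prop :=
  ‖ν‖ = 1 ∧ ∀ r : ℝ, IsUBCWith Ω r →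
    ball (x - r • ν) r ⊆ Ω ∧ ball (x + r • ν) r ⊆ Ωᶜ

/-- `∫_Ω |∇^k u|² dx`. -/
def derivSq (k : ℕ) (Ω : Set E2) (u : E2 → E2) : ℝ :=
  ∫ x in Ω, ‖iteratedFDeriv ℝ k u x‖^2

/-- Squared Sobolev norm `‖u‖²_{H^n(Ω)}`. -/
def hSobSq (n : ℕ) (Ω : Set E2) (u : E2 → E2) : ℝ :=
  ∑ k ∈ Finset.range (n + 1), derivSq k Ω u


/-- A bounded `C²`-regular domain in the plane, presented with its outer unit normal
(admitting a `C¹` extension near the boundary) and its scalar curvature, related by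
the Weingarten identity `κ = ⟨∂_τ ν, τ⟩`. -/
structure C2Domain where
  carrier : Set E2
  nu : E2 → E2
  kappa : E2 → ℝ
  isOpen : IsOpen carrier
  isConnected : IsConnected carrier
  isBounded : Bornology.IsBounded carrier
  ubc : ∃ r : ℝ, IsUBCWith carrier r
  nu_reg : ∃ U : Set E2, IsOpen U ∧ frontier carrier ⊆ U ∧ ContDiffOn ℝ 1 nu U
  nu_normal : ∀ x ∈ frontier carrier, IsOuterNormalAt carrier x (nu x)
  kappa_eq : ∀ x ∈ frontier carrier,
    kappa x = ⟪fderiv ℝ nu x (rot (nu x)), rot (nu x)⟫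


lemma rot_apply_zero (v : E2) : rot v 0 = - v 1 := by
  simp [rot, e, EuclideanSpace.inner_single_right]

lemma rot_apply_one (v : E2) : rot v 1 = v 0 := by
  simp [rot, e, EuclideanSpace.inner_single_right]

lemma inner_E2 (v w : E2) : ⟪v, w⟫ = v 0 * w 0 + v 1 * w 1 := by
  simp [PiLp.inner_apply, Fin.sum_univ_two]; ring

lemma rot_rot (v : E2) : rot (rot v) = -v := by
  ext i; fin_cases i <;> simp [rot_apply_zero, rot_apply_one]

lemma rot_add (v w : E2) : rot (v + w) = rot v + rot w := by
  ext i; fin_cases i <;> simp [rot_apply_zero, rot_apply_one]; ring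

lemma rot_smul (c : ℝ) (v : E2) : rot (c • v) = c • rot v := by
  ext i; fin_cases i <;> simp [rot_apply_zero, rot_apply_one]

lemma rot_continuous : Continuous rot := by
  unfold rot; fun_prop

lemma inner_rot_self (v : E2) : ⟪rot v, v⟫ = 0 := by
  rw [inner_E2, rot_apply_zero, rot_apply_one]; ring

lemma norm_rot (v : E2) : ‖rot v‖ = ‖v‖ := by
  have h : ‖rot v‖ ^ 2 = ‖v‖ ^ 2 := by
    rw [← real_inner_self_eq_norm_sq, ← real_inner_self_eq_norm_sq, inner_E2, inner_E2,
      rot_apply_zero, rot_apply_one]; ring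
  exact (sq_eq_sq₀ (norm_nonneg _) (norm_nonneg _)).1 h

lemma decomp (n v : E2) (hn : ‖n‖ = 1) :
    v = ⟪v, rot n⟫ • rot n + ⟪v, n⟫ • n := by
  have h : n 0 * n 0 + n 1 * n 1 = 1 := by
    rw [← inner_E2, real_inner_self_eq_norm_sq, hn]; norm_num
  ext i; fin_cases i <;> simp [rot_apply_zero, rot_apply_one, inner_E2] <;>
  [linear_combination (- v 0) * h; linear_combination (- v 1) * h]

lemma norm_sq_comb (n : E2) (hn : ‖n‖ = 1) (a b : ℝ) :
    ‖a • rot n + b • n‖ ^ 2 = a ^ 2 + b ^ 2 := by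
  have h : n 0 * n 0 + n 1 * n 1 = 1 := by
    rw [← inner_E2, real_inner_self_eq_norm_sq, hn]; norm_num
  rw [← real_inner_self_eq_norm_sq, inner_E2]
  simp [rot_apply_zero, rot_apply_one]
  linear_combination (a ^ 2 + b ^ 2) * h

lemma inner_comb (n w : E2) (a b : ℝ) :
    ⟪a • rot n + b • n, w⟫ = a * ⟪w, rot n⟫ + b * ⟪w, n⟫ := by
  rw [inner_add_left, inner_smul_left, inner_smul_left, real_inner_comm, real_inner_comm w n]; simp

lemma norm_sq_decomp (n v : E2) (hn : ‖n‖ = 1) :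
    ‖v‖ ^ 2 = ⟪v, rot n⟫ ^ 2 + ⟪v, n⟫ ^ 2 := by
  conv_lhs => rw [decomp n v hn]
  exact norm_sq_comb n hn _ _

structure Good (Ω : Set E2) (ν : E2 → E2) (r : ℝ) : Prop where
  op : IsOpen Ω
  bdd : Bornology.IsBounded Ω
  pos : 0 < r
  nu1 : ∀ x ∈ frontier Ω, ‖ν x‖ = 1
  inn : ∀ x ∈ frontier Ω, ball (x - r • ν x) r ⊆ Ω
  out : ∀ x ∈ frontier Ω, ball (x + r • ν x) r ⊆ Ωᶜ

section Aux

variable {Ω : Set E2} {ν : E2 → E2} {r : ℝ}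

lemma Good.inner_le (H : Good Ω ν r) {x y : E2} (hx : x ∈ frontier Ω) (hy : y ∈ frontier Ω) :
    2 * r * |⟪y - x, ν x⟫| ≤ ‖y - x‖ ^ 2 := by
  have h1 : y ∉ ball (x - r • ν x) r := fun h => by
    have : y ∈ interior Ω := by rw [H.op.interior_eq]; exact H.inn x hx h
    exact hy.2 this
  have h2 : y ∉ ball (x + r • ν x) r := fun h => by
    have h3 : y ∈ interior Ωᶜ := interior_maximal (H.out x hx) isOpen_ball h
    rw [interior_compl] at h3
    exact h3 hy.1
  rw [mem_ball, dist_eq_norm, not_lt] at h1 h2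
  have hr := H.pos
  have e1 : ‖y - (x - r • ν x)‖ ^ 2 = ‖y - x‖ ^ 2 + 2 * r * ⟪y - x, ν x⟫ + r ^ 2 := by
    rw [show y - (x - r • ν x) = (y - x) + r • ν x by abel, norm_add_sq_real, norm_smul,
      inner_smul_right, H.nu1 x hx, mul_one, Real.norm_eq_abs, sq_abs]; ring
  have e2 : ‖y - (x + r • ν x)‖ ^ 2 = ‖y - x‖ ^ 2 - 2 * r * ⟪y - x, ν x⟫ + r ^ 2 := by
    rw [show y - (x + r • ν x) = (y - x) - r • ν x by abel, norm_sub_sq_real, norm_smul,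
      inner_smul_right, H.nu1 x hx, mul_one, Real.norm_eq_abs, sq_abs]; ring
  have f1 := pow_le_pow_left₀ hr.le h1 2
  have f2 := pow_le_pow_left₀ hr.le h2 2
  rcases abs_cases ⟪y - x, ν x⟫ with h | h <;> rw [h.1] <;> linarith

lemma disj_ball {a b : E2} {r : ℝ} (h : Disjoint (ball a r) (ball b r)) :
    2 * r ≤ ‖a - b‖ := by
  by_contra hlt
  push Not at hlt
  refine (Set.disjoint_left.1 h : ∀ ⦃z⦄, z ∈ ball a r → z ∉ ball b r) (show midpoint ℝ a b ∈ _ from ?_) ?_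
  · rw [mem_ball, dist_midpoint_left, dist_eq_norm]; simp; linarith
  · rw [mem_ball, dist_midpoint_right, dist_eq_norm]; simp; linarith

lemma Good.lip (H : Good Ω ν r) {x y : E2} (hx : x ∈ frontier Ω) (hy : y ∈ frontier Ω) :
    r * ‖ν x - ν y‖ ≤ ‖x - y‖ := by
  have hr := H.pos
  have key : ∀ x ∈ frontier Ω, ∀ y ∈ frontier Ω,
      2 * r ≤ ‖(x - r • ν x) - (y + r • ν y)‖ := fun x hx y hy =>
    disj_ball (Set.disjoint_left.2 fun z h1 h2 => H.out y hy h2 (H.inn x hx h1))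
  have k1 := pow_le_pow_left₀ (by positivity) (key x hx y hy) 2
  have k2 := pow_le_pow_left₀ (by positivity) (key y hy x hx) 2
  rw [show (x - r • ν x) - (y + r • ν y) = (x - y) - r • (ν x + ν y) by
    rw [smul_add]; abel, norm_sub_sq_real, norm_smul, mul_pow _ ‖ν x + ν y‖, inner_smul_right,
    Real.norm_eq_abs, sq_abs] at k1
  rw [show (y - r • ν y) - (x + r • ν x) = -((x - y) + r • (ν x + ν y)) by
    rw [smul_add]; abel, norm_neg, norm_add_sq_real, norm_smul, mul_pow _ ‖ν x + ν y‖, inner_smul_right,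
    Real.norm_eq_abs, sq_abs] at k2
  have p := parallelogram_law_with_norm ℝ (ν x) (ν y)
  rw [H.nu1 x hx, H.nu1 y hy] at p
  have : (r * ‖ν x - ν y‖) ^ 2 ≤ ‖x - y‖ ^ 2 := by
    have e : (r * ‖ν x - ν y‖) ^ 2 = 4 * r ^ 2 - r ^ 2 * ‖ν x + ν y‖ ^ 2 := by
      linear_combination r ^ 2 * p
    rw [e]; nlinarith
  exact le_of_sq_le_sq this (norm_nonneg _)

lemma Good.exists_height (H : Good Ω ν r) {x : E2} (hx : x ∈ frontier Ω) {t : ℝ} (ht : |t| < r) :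
    ∃ s : ℝ, |s| ≤ t ^ 2 / r ∧ x + (t • rot (ν x) + s • ν x) ∈ frontier Ω := by
  have hr := H.pos
  rcases eq_or_ne t 0 with rfl | h0
  · exact ⟨0, by simp, by simpa using hx⟩
  have ht2 : 0 < t ^ 2 := by positivity
  have htr : t ^ 2 < r ^ 2 := by rw [sq_lt_sq, abs_of_pos hr]; exact ht
  set h := t ^ 2 / r with hh
  have hp : 0 < h := by positivity
  have hhr : h * r = t ^ 2 := by rw [hh]; field_simp
  have hlt : h < r := by nlinarith
  have n1 := H.nu1 x hx
  let c : ℝ → E2 := fun s => x + (t • rot (ν x) + s • ν x)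
  have hc : Continuous c := by fun_prop
  have hconn : IsPreconnected (c '' Icc (-h) h) :=
    isPreconnected_Icc.image c hc.continuousOn
  have hin : c (-h) ∈ Ω := by
    apply H.inn x hx
    rw [mem_ball, dist_eq_norm]
    apply lt_of_pow_lt_pow_left₀ 2 hr.le
    rw [show c (-h) - (x - r • ν x) = t • rot (ν x) + (r - h) • ν x by
      simp only [c]; rw [sub_smul, neg_smul]; abel, norm_sq_comb _ n1]
    nlinarith
  have hout : c h ∈ Ωᶜ := by
    apply H.out x hx
    rw [mem_ball, dist_eq_norm]
    apply lt_of_pow_lt_pow_left₀ 2 hr.le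
    rw [show c h - (x + r • ν x) = t • rot (ν x) + (h - r) • ν x by
      simp only [c]; rw [sub_smul]; abel, norm_sq_comb _ n1]
    nlinarith
  by_contra hcon
  push Not at hcon
  obtain ⟨z, -, hz1, hz2⟩ := hconn Ω (closure Ω)ᶜ H.op isClosed_closure.isOpen_compl (by
    rintro _ ⟨s, hs, rfl⟩
    by_contra h3
    rw [mem_union, not_or, mem_compl_iff, not_not] at h3
    refine hcon s (abs_le.2 hs) ⟨h3.2, ?_⟩
    rw [H.op.interior_eq]; exact h3.1)
    ⟨_, ⟨-h, ⟨le_refl _, by linarith⟩, rfl⟩, hin⟩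
    ⟨_, ⟨h, ⟨by linarith, le_refl _⟩, rfl⟩, fun hcl =>
      hcon h (abs_of_pos hp).le ⟨hcl, by rw [H.op.interior_eq]; exact hout⟩⟩
  exact hz2 (subset_closure hz1)

lemma Good.n_lower (H : Good Ω ν r) {x y : E2} (hx : x ∈ frontier Ω) (hy : y ∈ frontier Ω)
    (h : ‖y - x‖ ≤ r / 3) : 17 / 18 ≤ ⟪ν y, ν x⟫ := by
  have hr := H.pos
  have h1 := H.lip hy hx
  have h2 : ‖ν y - ν x‖ ≤ 1 / 3 := by
    by_contra h3
    push Not at h3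
    nlinarith
  have h4 := norm_sub_sq_real (ν y) (ν x)
  rw [H.nu1 x hx, H.nu1 y hy] at h4
  nlinarith [norm_nonneg (ν y - ν x)]

lemma abs_sq_le {m n : ℝ} (h : m ^ 2 + n ^ 2 = 1) (hn : 17 / 18 ≤ n) : |m| ≤ 1 / 3 + 1 / 100 := by
  apply abs_le_of_sq_le_sq _ (by norm_num)
  nlinarith

lemma Good.graph (H : Good Ω ν r) {x : E2} (hx : x ∈ frontier Ω) :
    ∃ f : ℝ → ℝ,
      (∀ t, |t| ≤ r / 4 → x + (t • rot (ν x) + f t • ν x) ∈ frontier Ω) ∧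
      (∀ t u, |t| ≤ r / 4 → |u| ≤ r / 4 → |f u - f t| ≤ |u - t|) ∧
      (∀ y ∈ frontier Ω, ‖y - x‖ ≤ r / 4 →
        y = x + (⟪y - x, rot (ν x)⟫ • rot (ν x) + f ⟪y - x, rot (ν x)⟫ • ν x)) ∧
      (∀ t, |t| ≤ r / 4 → 17 / 18 ≤ ⟪ν (x + (t • rot (ν x) + f t • ν x)), ν x⟫) ∧
      (∀ t u, |t| ≤ r / 4 → |u| ≤ r / 4 →
        r * |(u - t) * ⟪ν (x + (t • rot (ν x) + f t • ν x)), rot (ν x)⟫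
          + (f u - f t) * ⟪ν (x + (t • rot (ν x) + f t • ν x)), ν x⟫| ≤ (u - t) ^ 2) := by
  have hr := H.pos
  have n1 := H.nu1 x hx
  have hex : ∀ t : ℝ, ∃ s : ℝ, |t| ≤ r / 4 →
      |s| ≤ t ^ 2 / r ∧ x + (t • rot (ν x) + s • ν x) ∈ frontier Ω := fun t => by
    by_cases ht : |t| ≤ r / 4
    · obtain ⟨s, hs⟩ := H.exists_height hx (t := t) (by linarith)
      exact ⟨s, fun _ => hs⟩
    · exact ⟨0, fun h => absurd h ht⟩
  choose f hf using hex
  have fb : ∀ t, |t| ≤ r / 4 → |f t| ≤ r / 16 := fun t ht => by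
    refine (hf t ht).1.trans ?_
    rw [div_le_iff₀ hr]
    have := sq_le_sq' (by linarith [(abs_le.1 ht).1]) (abs_le.1 ht).2
    nlinarith
  have near : ∀ t, |t| ≤ r / 4 → ‖x + (t • rot (ν x) + f t • ν x) - x‖ ≤ r / 3 := fun t ht => by
    rw [add_sub_cancel_left]
    apply le_of_sq_le_sq _ (by positivity)
    rw [norm_sq_comb _ n1]
    have h1 := sq_le_sq' (by linarith [(abs_le.1 ht).1]) (abs_le.1 ht).2
    have h2 := sq_le_sq' (by linarith [(abs_le.1 (fb t ht)).1]) (abs_le.1 (fb t ht)).2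
    nlinarith
  have nl : ∀ t, |t| ≤ r / 4 → 17 / 18 ≤ ⟪ν (x + (t • rot (ν x) + f t • ν x)), ν x⟫ :=
    fun t ht => H.n_lower hx (hf t ht).2 (near t ht)
  have quad : ∀ t u, |t| ≤ r / 4 → |u| ≤ r / 4 →
        2 * r * |(u - t) * ⟪ν (x + (t • rot (ν x) + f t • ν x)), rot (ν x)⟫
          + (f u - f t) * ⟪ν (x + (t • rot (ν x) + f t • ν x)), ν x⟫| ≤
          (u - t) ^ 2 + (f u - f t) ^ 2 := fun t u ht hu => by
    have := H.inner_le (hf t ht).2 (hf u hu).2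
    rw [show x + (u • rot (ν x) + f u • ν x) - (x + (t • rot (ν x) + f t • ν x)) =
      (u - t) • rot (ν x) + (f u - f t) • ν x by rw [sub_smul, sub_smul]; abel,
      norm_sq_comb _ n1, inner_comb] at this
    exact this
  have lip : ∀ t u, |t| ≤ r / 4 → |u| ≤ r / 4 → |f u - f t| ≤ |u - t| := fun t u ht hu => by
    have q := quad t u ht hu
    set m := ⟪ν (x + (t • rot (ν x) + f t • ν x)), rot (ν x)⟫
    set n := ⟪ν (x + (t • rot (ν x) + f t • ν x)), ν x⟫
    have hn : 17 / 18 ≤ n := nl t ht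
    have hm : |m| ≤ 1 / 3 + 1 / 100 := by
      refine abs_sq_le (n := n) ?_ hn
      rw [← norm_sq_decomp (ν x) _ n1, H.nu1 _ (hf t ht).2]; norm_num
    have hut : |u - t| ≤ r / 2 := (abs_sub _ _).trans (by linarith)
    have hff : |f u - f t| ≤ r / 8 := (abs_sub _ _).trans (by linarith [fb t ht, fb u hu])
    rw [← sq_abs (u - t), ← sq_abs (f u - f t)] at q
    have h3 : |(f u - f t) * n| ≤ |(u - t) * m + (f u - f t) * n| + |(u - t) * m| := by
      have := abs_sub ((u - t) * m + (f u - f t) * n) ((u - t) * m)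
      rwa [add_sub_cancel_left] at this
    rw [abs_mul, abs_mul (u - t), abs_of_pos (by linarith : 0 < n)] at h3
    generalize |(u - t) * m + (f u - f t) * n| = Q at q h3
    have ha : 0 ≤ |u - t| := abs_nonneg _
    generalize |u - t| = a at *
    generalize hb : |f u - f t| = b at *
    have hb0 : 0 ≤ b := by rw [← hb]; positivity
    by_contra hab
    push Not at hab
    have ha0 : 0 ≤ |m| := abs_nonneg m
    have q2 : 2 * r * Q ≤ r * (a / 2 + b / 8) := by nlinarith
    have q3 : 2 * Q ≤ a / 2 + b / 8 := by
      by_contra h; push Not at h; nlinarith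
    nlinarith
  refine ⟨f, fun t ht => (hf t ht).2, lip, ?_, nl, ?_⟩
  · intro y hy hyx
    have hd := decomp (ν x) (y - x) n1
    have hns := norm_sq_decomp (ν x) (y - x) n1
    set t := ⟪y - x, rot (ν x)⟫
    set s := ⟪y - x, ν x⟫
    have ht : |t| ≤ r / 4 := by
      refine le_trans ?_ hyx
      apply abs_le_of_sq_le_sq _ (norm_nonneg _); nlinarith
    have hs : |s| ≤ r / 4 := by
      refine le_trans ?_ hyx
      apply abs_le_of_sq_le_sq _ (norm_nonneg _); nlinarith
    have hy' : y = x + (t • rot (ν x) + s • ν x) := by rw [← hd]; abel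
    have q := H.inner_le (hf t ht).2 hy
    rw [show y - (x + (t • rot (ν x) + f t • ν x)) = (0 : ℝ) • rot (ν x) + (s - f t) • ν x by
      nth_rewrite 1 [hy']; rw [sub_smul, zero_smul]; abel, norm_sq_comb _ n1, inner_comb] at q
    have hn := nl t ht
    have hsf : |s - f t| ≤ r / 2 := (abs_sub _ _).trans (by linarith [fb t ht])
    have : |s - f t| = 0 := by
      rw [zero_mul, zero_add, abs_mul, abs_of_pos (by linarith : 0 < ⟪ν (x + (t • rot (ν x) + f t • ν x)), ν x⟫), ← sq_abs (s - f t)] at q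
      generalize ⟪ν (x + (t • rot (ν x) + f t • ν x)), ν x⟫ = n at *
      have h0 := abs_nonneg (s - f t)
      generalize |s - f t| = b at *
      by_contra hb
      have hb' : 0 < b := lt_of_le_of_ne h0 (Ne.symm hb)
      have : r * b * (17 / 9) ≤ 2 * r * (b * n) := by nlinarith [mul_pos hr hb']
      nlinarith [mul_pos hr hb']
    have hsft : s = f t := by linarith [abs_eq_zero.1 this]
    rw [← hsft]; exact hy'
  · intro t u ht hu
    have q := quad t u ht hu
    have l := sq_le_sq.2 (lip t u ht hu)
    nlinarith

lemma Good.continuousOn_nu (H : Good Ω ν r) : ContinuousOn ν (frontier Ω) := by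
  have hr := H.pos
  have : LipschitzOnWith (Real.toNNReal r⁻¹) ν (frontier Ω) := by
    apply LipschitzOnWith.of_dist_le_mul
    intro x hx y hy
    rw [dist_eq_norm, dist_eq_norm, Real.coe_toNNReal _ (by positivity), inv_mul_eq_div,
      le_div_iff₀ hr, mul_comm]
    exact H.lip hx hy
  exact this.continuousOn

lemma Good.param (H : Good Ω ν r) {x : E2} (hx : x ∈ frontier Ω) :
    ∃ γ : ℝ → E2, ∃ c : ℝ → ℝ,
      (∀ t ∈ Icc (-(r / 4)) (r / 4), γ t ∈ frontier Ω) ∧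
      LipschitzOnWith 2 γ (Icc (-(r / 4)) (r / 4)) ∧
      (∀ t, ⟪γ t - x, rot (ν x)⟫ = t) ∧
      (∀ y ∈ frontier Ω, ‖y - x‖ ≤ r / 4 → y = γ ⟪y - x, rot (ν x)⟫) ∧
      (∀ t ∈ Icc (-(r / 4)) (r / 4), |c t| ≤ 2) ∧
      (∀ t ∈ Ioo (-(r / 4)) (r / 4), HasDerivAt γ (c t • rot (ν (γ t))) t) ∧
      ContinuousOn c (Icc (-(r / 4)) (r / 4)) := by
  have hr := H.pos
  have n1 := H.nu1 x hx
  obtain ⟨f, h1, h2, h3, h4, h5⟩ := H.graph hx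
  set γ : ℝ → E2 := fun t => x + (t • rot (ν x) + f t • ν x) with hγ
  have hlip : LipschitzOnWith 2 γ (Icc (-(r / 4)) (r / 4)) := by
    apply LipschitzOnWith.of_dist_le_mul
    intro u hu t ht
    rw [dist_eq_norm, dist_eq_norm, Real.norm_eq_abs]
    have l := sq_le_sq.2 (h2 t u (abs_le.2 ht) (abs_le.2 hu))
    apply le_of_sq_le_sq _ (by positivity)
    rw [show γ u - γ t = (u - t) • rot (ν x) + (f u - f t) • ν x by
      simp only [hγ]; rw [sub_smul, sub_smul]; abel, norm_sq_comb _ n1, mul_pow, sq_abs]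
    simp only [NNReal.coe_ofNat]
    nlinarith
  refine ⟨γ, fun t => (⟪ν (γ t), ν x⟫)⁻¹, fun t ht => h1 t (abs_le.2 ht), hlip, ?_, h3, ?_, ?_, ?_⟩
  · intro t
    simp only [hγ, add_sub_cancel_left]
    rw [inner_comb, real_inner_self_eq_norm_sq, inner_rot_self, norm_rot, n1]; ring
  · intro t ht
    have := h4 t (abs_le.2 ht)
    change 17 / 18 ≤ ⟪ν (γ t), ν x⟫ at this
    rw [abs_of_pos (by positivity), inv_le_comm₀ (by linarith) (by norm_num)]
    linarith
  · intro t ht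
    have ht' := abs_le.2 (Ioo_subset_Icc_self ht)
    have hn := h4 t ht'
    have h5' := fun u hu => h5 t u ht' hu
    change 17 / 18 ≤ ⟪ν (γ t), ν x⟫ at hn
    change ∀ u, _ → r * |(u - t) * ⟪ν (γ t), rot (ν x)⟫ + (f u - f t) * ⟪ν (γ t), ν x⟫| ≤ _ at h5'
    have hdec := decomp (ν x) (ν (γ t)) n1
    set m := ⟪ν (γ t), rot (ν x)⟫ with hm
    set n := ⟪ν (γ t), ν x⟫ with hnn
    have hn0 : 0 < n := by linarith
    have hf : HasDerivAt f (-m / n) t := by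
      rw [hasDerivAt_iff_isLittleO]
      have hO : (fun u => f u - f t - (u - t) • (-m / n)) =O[𝓝 t] fun u => (u - t) ^ 2 := by
        apply Asymptotics.IsBigO.of_bound (1 / (r * n))
        filter_upwards [Ioo_mem_nhds ht.1 ht.2] with u hu
        have := h5' u (abs_le.2 (Ioo_subset_Icc_self hu))
        rw [show f u - f t - (u - t) • (-m / n) = ((u - t) * m + (f u - f t) * n) / n by
          simp only [smul_eq_mul]; field_simp; ring, Real.norm_eq_abs, Real.norm_eq_abs, abs_div, abs_of_pos hn0,
          abs_of_nonneg (sq_nonneg (u - t)), div_le_iff₀ hn0]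
        rw [show 1 / (r * n) * (u - t) ^ 2 * n = (u - t) ^ 2 / r by field_simp, le_div_iff₀ hr]
        linarith
      refine hO.trans_isLittleO ?_
      have := Asymptotics.isLittleO_pow_sub_sub t (one_lt_two)
      simpa only [Real.norm_eq_abs, sq_abs] using this
    have hd : HasDerivAt γ ((1 : ℝ) • rot (ν x) + (-m / n) • ν x) t :=
      (((hasDerivAt_id t).smul_const _).add (hf.smul_const _)).const_add x
    convert hd using 1
    change n⁻¹ • rot (ν (γ t)) = _
    rw [hdec, rot_add, rot_smul, rot_smul, rot_rot, smul_add, smul_smul, smul_smul, smul_neg,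
      inv_mul_cancel₀ hn0.ne', add_comm, ← neg_smul]
    congr 2
    field_simp
  · have hc : ContinuousOn (fun t => ν (γ t)) (Icc (-(r / 4)) (r / 4)) :=
      H.continuousOn_nu.comp hlip.continuousOn fun t ht => h1 t (abs_le.2 ht)
    refine ContinuousOn.inv₀ (hc.inner continuousOn_const) ?_
    intro t ht
    have := h4 t (abs_le.2 ht)
    change 17 / 18 ≤ ⟪ν (γ t), ν x⟫ at this
    linarith

/-- The projection argument: Lebesgue measure on the parameter interval is dominated by `H¹`. -/
lemma lintegral_param_le {S : Set E2} {x w : E2} (hw : ‖w‖ = 1) {γ : ℝ → E2} {a b : ℝ}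
    (hγ : ∀ t ∈ Icc a b, γ t ∈ S) (hc : ContinuousOn γ (Icc a b))
    (hp : ∀ t, ⟪γ t - x, w⟫ = t) (F : E2 → ℝ≥0∞) :
    ∫⁻ t in Icc a b, F (γ t) ≤ ∫⁻ y in S, F y ∂μH[1] := by
  set π : E2 → ℝ := fun y => ⟪y - x, w⟫ with hπ
  have hπl : LipschitzWith 1 π := by
    apply LipschitzWith.of_dist_le_mul
    intro y z
    rw [Real.dist_eq, dist_eq_norm, NNReal.coe_one, one_mul]
    rw [show π y - π z = ⟪y - z, w⟫ by simp only [hπ]; rw [← inner_sub_left]; congr 1; abel]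
    simpa [hw] using abs_real_inner_le_norm (y - z) w
  have hπm : Measurable π := hπl.continuous.measurable
  set Γ := γ '' Icc a b
  have hΓ : MeasurableSet Γ := (isCompact_Icc.image_of_continuousOn hc).measurableSet
  have hle : volume.restrict (Icc a b) ≤ ((μH[1] : Measure E2).restrict Γ).map π := by
    rw [Measure.le_iff]
    intro B hB
    rw [Measure.restrict_apply hB, Measure.map_apply hπm hB, Measure.restrict_apply (hπm hB),
      ← hausdorffMeasure_real]
    calc μH[1] (B ∩ Icc a b) ≤ μH[1] (π '' (π ⁻¹' B ∩ Γ)) := by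
          apply measure_mono
          rintro t ⟨htB, ht⟩
          exact ⟨γ t, ⟨by simpa [hπ, hp] using htB, t, ht, rfl⟩, hp t⟩
      _ ≤ μH[1] (π ⁻¹' B ∩ Γ) := by
          simpa using hπl.hausdorffMeasure_image_le (d := 1) zero_le_one (π ⁻¹' B ∩ Γ)
  calc ∫⁻ t in Icc a b, F (γ t) ≤ ∫⁻ t, F (γ t) ∂(((μH[1] : Measure E2).restrict Γ).map π) :=
        lintegral_mono' hle le_rfl
    _ ≤ ∫⁻ y, F (γ (π y)) ∂((μH[1] : Measure E2).restrict Γ) := lintegral_map_le _ _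
    _ = ∫⁻ y in Γ, F y ∂μH[1] := by
        apply setLIntegral_congr_fun hΓ
        rintro _ ⟨t, ht, rfl⟩
        simp only [hπ, hp]
    _ ≤ ∫⁻ y in S, F y ∂μH[1] := lintegral_mono_set (by
        rintro _ ⟨t, ht, rfl⟩; exact hγ t ht)

lemma Good.compact (H : Good Ω ν r) : IsCompact (frontier Ω) :=
  Metric.isCompact_of_isClosed_isBounded isClosed_frontier
    (H.bdd.closure.subset frontier_subset_closure)

lemma Good.abs_inner_le (H : Good Ω ν r) {x y : E2} (hx : x ∈ frontier Ω) :
    |⟪y - x, rot (ν x)⟫| ≤ ‖y - x‖ := by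
  simpa [norm_rot, H.nu1 x hx] using abs_real_inner_le_norm (y - x) (rot (ν x))

lemma Good.finite (H : Good Ω ν r) : (μH[1] : Measure E2) (frontier Ω) < ∞ := by
  have hr := H.pos
  refine H.compact.measure_lt_top_of_nhdsWithin fun x hx => ?_
  obtain ⟨γ, c, h1, h2, h3, h4, -⟩ := H.param hx
  refine ⟨frontier Ω ∩ ball x (r / 4), inter_mem_nhdsWithin _ (ball_mem_nhds x (by positivity)), ?_⟩
  calc (μH[1] : Measure E2) (frontier Ω ∩ ball x (r / 4))
      ≤ μH[1] (γ '' Icc (-(r / 4)) (r / 4)) := by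
        apply measure_mono
        rintro y ⟨hy, hyb⟩
        rw [mem_ball, dist_eq_norm] at hyb
        exact ⟨_, abs_le.1 ((H.abs_inner_le hx).trans hyb.le), (h4 y hy hyb.le).symm⟩
    _ ≤ _ := h2.hausdorffMeasure_image_le zero_le_one
    _ < ∞ := by
        rw [hausdorffMeasure_real, Real.volume_Icc]
        exact ENNReal.mul_lt_top (by simp) ENNReal.ofReal_lt_top

lemma Good.integrableOn (H : Good Ω ν r) {F : E2 → ℝ} (hF : ContinuousOn F (frontier Ω)) :
    IntegrableOn F (frontier Ω) μH[1] := by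
  obtain ⟨C, hC⟩ := H.compact.exists_bound_of_continuousOn hF
  have : IsFiniteMeasure ((μH[1] : Measure E2).restrict (frontier Ω)) :=
    ⟨by rw [Measure.restrict_apply_univ]; exact H.finite⟩
  exact Integrable.of_bound (hF.aestronglyMeasurable isClosed_frontier.measurableSet) C
    ((ae_restrict_iff' isClosed_frontier.measurableSet).2 (ae_of_all _ hC))

lemma cauchy_interval {K : ℝ → ℝ} {a b : ℝ} (hab : a ≤ b) (hK : ContinuousOn K (Icc a b)) :
    (∫ t in a..b, K t) ^ 2 ≤ (b - a) * ∫ t in a..b, K t ^ 2 := by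
  rcases hab.eq_or_lt with rfl | hlt
  · simp
  have hL : 0 < b - a := sub_pos.2 hlt
  rw [← uIcc_of_le hab] at hK
  have i1 : IntervalIntegrable K volume a b := hK.intervalIntegrable
  have i2 : IntervalIntegrable (fun t => K t ^ 2) volume a b := (hK.pow 2).intervalIntegrable
  set p := ∫ t in a..b, K t with hp
  set c := p / (b - a) with hc
  have h0 : 0 ≤ ∫ t in a..b, (K t - c) ^ 2 :=
    intervalIntegral.integral_nonneg hab fun t _ => sq_nonneg _
  have h1 : ∫ t in a..b, (K t - c) ^ 2 = (∫ t in a..b, K t ^ 2) - 2 * c * p + (b - a) * c ^ 2 := by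
    have : (fun t => (K t - c) ^ 2) = fun t => (K t ^ 2 - 2 * c * K t) + c ^ 2 := by
      funext t; ring
    rw [this, intervalIntegral.integral_add (i2.sub (i1.const_mul _)) (by simp),
      intervalIntegral.integral_sub i2 (i1.const_mul _), intervalIntegral.integral_const_mul,
      intervalIntegral.integral_const]
    simp [hp]
  rw [h1] at h0
  have hcp : c * (b - a) = p := by rw [hc]; field_simp
  have : 0 ≤ (b - a) * ((∫ t in a..b, K t ^ 2) - 2 * c * p + (b - a) * c ^ 2) := by positivity
  have h2 : (b - a) * ((∫ t in a..b, K t ^ 2) - 2 * c * p + (b - a) * c ^ 2)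
    = (b - a) * (∫ t in a..b, K t ^ 2) - p ^ 2 := by
    linear_combination (-2 * p + (c * (b - a) + p)) * hcp
  linarith

lemma integral_param_le {S : Set E2} {x w : E2} (hw : ‖w‖ = 1) {γ : ℝ → E2} {a b : ℝ} (hab : a ≤ b)
    (hγ : ∀ t ∈ Icc a b, γ t ∈ S) (hc : ContinuousOn γ (Icc a b))
    (hp : ∀ t, ⟪γ t - x, w⟫ = t) (F : E2 → ℝ) (hF0 : ∀ y, 0 ≤ F y) (hFc : ContinuousOn F S)
    (hF : IntegrableOn F S μH[1]) :
    ∫ t in a..b, F (γ t) ≤ ∫ y in S, F y ∂μH[1] := by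
  rw [intervalIntegral.integral_of_le hab, ← integral_Icc_eq_integral_Ioc]
  have hcomp : ContinuousOn (fun t => F (γ t)) (Icc a b) := hFc.comp hc hγ
  rw [integral_eq_lintegral_of_nonneg_ae (ae_of_all _ fun t => hF0 _)
    (hcomp.aestronglyMeasurable measurableSet_Icc),
    integral_eq_lintegral_of_nonneg_ae (ae_of_all _ fun t => hF0 _) hF.aestronglyMeasurable]
  refine ENNReal.toReal_mono ?_ (lintegral_param_le hw hγ hc hp fun y => ENNReal.ofReal (F y))
  exact hF.lintegral_lt_top.ne

lemma Good.continuousOn_tang (H : Good Ω ν r) {g : E2 → ℝ} (hg : ContDiff ℝ 1 g) :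
    ContinuousOn (fun y => fderiv ℝ g y (rot (ν y))) (frontier Ω) :=
  (hg.continuous_fderiv one_ne_zero).continuousOn.clm_apply
    (rot_continuous.comp_continuousOn H.continuousOn_nu)

lemma Good.local_est (H : Good Ω ν r) {g : E2 → ℝ} (hg : ContDiff ℝ 1 g) {x y : E2}
    (hx : x ∈ frontier Ω) (hy : y ∈ frontier Ω) (hxy : ‖y - x‖ ≤ r / 8) :
    |g y - g x| ≤ 2 * √‖y - x‖ * √(bInt Ω fun y => (fderiv ℝ g y (rot (ν y))) ^ 2) := by
  have hr := H.pos
  obtain ⟨γ, c, h1, h2, h3, h4, h5, h6, h7⟩ := H.param hx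
  set h : E2 → ℝ := fun y => fderiv ℝ g y (rot (ν y)) with hh
  have hhc : ContinuousOn h (frontier Ω) := H.continuousOn_tang hg
  set I := bInt Ω fun y => (h y) ^ 2 with hI
  have hI0 : 0 ≤ I := integral_nonneg fun _ => sq_nonneg _
  have main : ∀ a b, a ≤ b → |a| ≤ r / 8 → |b| ≤ r / 8 →
      (g (γ b) - g (γ a)) ^ 2 ≤ (b - a) * (4 * I) := by
    intro a b hab ha hb
    have sub : Icc a b ⊆ Ioo (-(r / 4)) (r / 4) := fun t ht =>
      ⟨by linarith [ht.1, (abs_le.1 ha).1], by linarith [ht.2, (abs_le.1 hb).2]⟩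
    have sub' := sub.trans Ioo_subset_Icc_self
    have hγc : ContinuousOn γ (Icc a b) := h2.continuousOn.mono sub'
    have hγm : ∀ t ∈ Icc a b, γ t ∈ frontier Ω := fun t ht => h1 t (sub' ht)
    have hhγ : ContinuousOn (fun t => h (γ t)) (Icc a b) := hhc.comp hγc hγm
    have hK : ContinuousOn (fun t => c t * h (γ t)) (Icc a b) := (h7.mono sub').mul hhγ
    have hder : ∀ t ∈ uIcc a b, HasDerivAt (fun t => g (γ t)) (c t * h (γ t)) t := by
      intro t ht
      rw [uIcc_of_le hab] at ht
      have := ((hg.differentiable one_ne_zero (γ t)).hasFDerivAt.comp_hasDerivAt t (h6 t (sub ht)))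
      simpa [hh, Function.comp_def] using this
    have ftc := intervalIntegral.integral_eq_sub_of_hasDerivAt hder
      (by rw [← uIcc_of_le hab] at hK; exact hK.intervalIntegrable)
    rw [← ftc]
    refine (cauchy_interval hab hK).trans ?_
    refine mul_le_mul_of_nonneg_left ?_ (sub_nonneg.2 hab)
    calc ∫ t in a..b, (c t * h (γ t)) ^ 2 ≤ ∫ t in a..b, 4 * h (γ t) ^ 2 := by
          apply intervalIntegral.integral_mono_on hab
          · rw [← uIcc_of_le hab] at hK; exact (hK.pow 2).intervalIntegrable
          · rw [← uIcc_of_le hab] at hhγ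
            exact (continuousOn_const.mul (hhγ.pow 2)).intervalIntegrable
          · intro t ht
            rw [mul_pow]
            refine mul_le_mul_of_nonneg_right ?_ (sq_nonneg _)
            have := abs_le.1 (h5 t (sub' ht))
            nlinarith
      _ = 4 * ∫ t in a..b, h (γ t) ^ 2 := intervalIntegral.integral_const_mul _ _
      _ ≤ 4 * I := by
          refine mul_le_mul_of_nonneg_left ?_ (by norm_num)
          exact integral_param_le (w := rot (ν x)) (by rw [norm_rot, H.nu1 x hx]) hab hγm hγc h3
            (fun y => h y ^ 2) (fun _ => sq_nonneg _) (hhc.pow 2) (H.integrableOn (hhc.pow 2))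
  have hy' := h4 y hy (by linarith)
  have hx' := h4 x hx (by simp; linarith)
  have ht := H.abs_inner_le (y := y) hx
  set t := ⟪y - x, rot (ν x)⟫
  rw [sub_self, inner_zero_left] at hx'
  have hsq : (g y - g x) ^ 2 ≤ ‖y - x‖ * (4 * I) := by
    rw [hy', hx']
    rw [← hy', ← hx']
    have h0 : |(0 : ℝ)| ≤ r / 8 := by simp; linarith
    rcases le_total 0 t with h | h
    · have := main 0 t h h0 (ht.trans hxy)
      rw [← hy', ← hx'] at this
      refine this.trans (mul_le_mul_of_nonneg_right ?_ (by positivity))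
      linarith [le_abs_self t]
    · have := main t 0 h (ht.trans hxy) h0
      rw [← hy', ← hx'] at this
      rw [show (g y - g x) ^ 2 = (g x - g y) ^ 2 by ring]
      refine this.trans (mul_le_mul_of_nonneg_right ?_ (by positivity))
      linarith [neg_abs_le t]
  apply abs_le_of_sq_le_sq _ (by positivity)
  rw [mul_pow, mul_pow, Real.sq_sqrt (norm_nonneg _), Real.sq_sqrt hI0]
  linarith

lemma Good.mid (H : Good Ω ν r) {x y : E2}
    (hx : x ∈ frontier Ω) (hy : y ∈ frontier Ω) (hxy : ‖y - x‖ ≤ r) :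
    ∃ z ∈ frontier Ω, ‖z - x‖ ≤ 19 / 20 * ‖y - x‖ ∧ ‖y - z‖ ≤ 19 / 20 * ‖y - x‖ := by
  have hr := H.pos
  have n1 := H.nu1 x hx
  have hd := decomp (ν x) (y - x) n1
  have hns := norm_sq_decomp (ν x) (y - x) n1
  have hin := H.inner_le hx hy
  have ht := H.abs_inner_le (y := y) hx
  set t := ⟪y - x, rot (ν x)⟫
  set s := ⟪y - x, ν x⟫
  have hd0 := norm_nonneg (y - x)
  obtain ⟨s', hs', hz⟩ := H.exists_height hx (t := t / 2) (by
    rw [abs_div, abs_two]; linarith)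
  rw [le_div_iff₀ hr] at hs'
  set d := ‖y - x‖ with hdd
  have ht2 : t ^ 2 ≤ d ^ 2 := by nlinarith
  have hs2 : |s| ≤ d / 2 := by
    by_contra hcon; push Not at hcon; nlinarith
  have hs3 : |s'| ≤ d / 4 := by
    by_contra hcon; push Not at hcon; nlinarith
  have hs4 : |s - s'| ≤ 3 / 4 * d := (abs_sub _ _).trans (by linarith)
  refine ⟨_, hz, ?_, ?_⟩
  · apply le_of_sq_le_sq _ (by positivity)
    rw [add_sub_cancel_left, norm_sq_comb _ n1]
    have := sq_le_sq' (by linarith [(abs_le.1 hs3).1]) (abs_le.1 hs3).2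
    nlinarith
  · apply le_of_sq_le_sq _ (by positivity)
    rw [show y - (x + ((t / 2) • rot (ν x) + s' • ν x)) =
      (t / 2) • rot (ν x) + (s - s') • ν x by
        rw [← sub_sub, hd, sub_smul, show t • rot (ν x) = (t / 2 + t / 2) • rot (ν x) by ring_nf, add_smul]
        abel, norm_sq_comb _ n1]
    have := sq_le_sq' (by linarith [(abs_le.1 hs4).1]) (abs_le.1 hs4).2
    nlinarith

lemma Good.chain (H : Good Ω ν r) {g : E2 → ℝ} (hg : ContDiff ℝ 1 g) (k : ℕ) : ∀ x y : E2,
    x ∈ frontier Ω → y ∈ frontier Ω → ‖y - x‖ ≤ r → (19 / 20) ^ k * ‖y - x‖ ≤ r / 8 →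
    |g y - g x| ≤ 2 * 2 ^ k * √‖y - x‖ * √(bInt Ω fun y => (fderiv ℝ g y (rot (ν y))) ^ 2) := by
  induction k with
  | zero =>
    intro x y hx hy _ h
    simpa using H.local_est hg hx hy (by simpa using h)
  | succ k ih =>
    intro x y hx hy hr h
    obtain ⟨z, hz, h1, h2⟩ := H.mid hx hy hr
    have hd0 := norm_nonneg (y - x)
    set I := bInt Ω fun y => (fderiv ℝ g y (rot (ν y))) ^ 2
    have hp : (0 : ℝ) ≤ (19 / 20) ^ k := by positivity
    have step : ∀ d, d ≤ 19 / 20 * ‖y - x‖ → (19 / 20) ^ k * d ≤ r / 8 := fun d hd => by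
      refine le_trans (mul_le_mul_of_nonneg_left hd hp) ?_
      rw [pow_succ] at h; linarith
    have a1 := ih x z hx hz (by linarith) (step _ h1)
    have a2 := ih z y hz hy (by linarith) (step _ h2)
    have b : ∀ d, d ≤ 19 / 20 * ‖y - x‖ → 2 * 2 ^ k * √d * √I ≤ 2 * 2 ^ k * √‖y - x‖ * √I :=
      fun d hd => by gcongr; linarith
    have := abs_sub_le (g y) (g z) (g x)
    have b1 := b _ h1
    have b2 := b _ h2
    rw [pow_succ]
    nlinarith

lemma Good.pair (H : Good Ω ν r) {g : E2 → ℝ} (hg : ContDiff ℝ 1 g) {x y : E2}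
    (hx : x ∈ frontier Ω) (hy : y ∈ frontier Ω) (hxy : ‖y - x‖ ≤ r) :
    |g y - g x| ≤ 2 * 2 ^ 41 * √‖y - x‖ * √(bInt Ω fun y => (fderiv ℝ g y (rot (ν y))) ^ 2) := by
  refine H.chain hg 41 x y hx hy hxy ?_
  have : ((19 : ℝ) / 20) ^ 41 ≤ 1 / 8 := by norm_num
  nlinarith [norm_nonneg (y - x)]

lemma Good.integral_pos (H : Good Ω ν r) {φ : E2 → ℝ} (hc : ContinuousOn φ (frontier Ω))
    (h0 : ∀ y, 0 ≤ φ y) {x : E2} (hx : x ∈ frontier Ω) (hφ : φ x ≠ 0) : 0 < bInt Ω φ := by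
  have hr := H.pos
  obtain ⟨γ, c, h1, h2, h3, h4, -⟩ := H.param hx
  have hx' := h4 x hx (by simp; linarith)
  rw [sub_self, inner_zero_left] at hx'
  have sub : Icc 0 (r / 4) ⊆ Icc (-(r / 4)) (r / 4) := Icc_subset_Icc_left (by linarith)
  have hcγ : ContinuousOn γ (Icc 0 (r / 4)) := h2.continuousOn.mono sub
  refine lt_of_lt_of_le ?_ (integral_param_le (w := rot (ν x)) (by rw [norm_rot, H.nu1 x hx])
    (by positivity : 0 ≤ r / 4) (fun t ht => h1 t (sub ht)) hcγ h3 φ h0 hc (H.integrableOn hc))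
  have hcomp : ContinuousOn (fun t => φ (γ t)) (Icc 0 (r / 4)) :=
    hc.comp hcγ fun t ht => h1 t (sub ht)
  refine intervalIntegral.integral_pos (by positivity) hcomp (fun t _ => h0 _)
    ⟨0, ⟨le_rfl, by positivity⟩, ?_⟩
  rw [← hx']
  exact lt_of_le_of_ne (h0 x) (Ne.symm hφ)

end Aux

/-- Proposition 6.4, Campanato-type estimate on the boundary: for a
bounded `C²`-regular domain, `x₀ ∈ ∂Ω`, `0 < ρ < r_Ω` and a weight
`φ ∈ C₀(B_ρ(x₀) ∩ ∂Ω; [0,1])` which is not identically zero, every `g ∈ C¹(∂Ω)` satisfies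
`|g(x) - (∫_{∂Ω} φ)⁻¹ ∫_{∂Ω} φ g| ≤ C ρ^{1/2} ‖∂_τ g‖_{L²(∂Ω)}` for all
`x ∈ B_ρ(x₀) ∩ ∂Ω`, with an independent constant `C`. -/
theorem boundary_campanato :
    ∃ C : ℝ, ∀ D : C2Domain, ∀ x₀ ∈ frontier D.carrier, ∀ ρ : ℝ,
      0 < ρ → ρ < ubcRadius D.carrier →
      ∀ φ : E2 → ℝ, ContinuousOn φ (frontier D.carrier) →
        (∀ x : E2, 0 ≤ φ x ∧ φ x ≤ 1) →
        (∀ x ∈ frontier D.carrier, φ x ≠ 0 → x ∈ ball x₀ ρ) →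
        (∃ x ∈ frontier D.carrier, φ x ≠ 0) →
      ∀ g : E2 → ℝ, ContDiff ℝ 1 g →
      ∀ x ∈ ball x₀ ρ ∩ frontier D.carrier,
        |g x - (bInt D.carrier φ)⁻¹ * bInt D.carrier (fun y => φ y * g y)| ≤
          C * Real.sqrt ρ *
            Real.sqrt (bInt D.carrier (fun y => (fderiv ℝ g y (rot (D.nu y)))^2)) := by
  refine ⟨2 * (2 * 2 ^ 41), ?_⟩
  intro D x₀ hx₀ ρ hρ hρr φ hφc hφ01 hφs ⟨z, hz, hφz⟩ g hg x ⟨hxb, hx⟩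
  obtain ⟨r, hr, hlt⟩ := exists_lt_of_lt_csSup
    (show {r : ℝ | IsUBCWith D.carrier r}.Nonempty from D.ubc) hρr
  have H : Good D.carrier D.nu r :=
    ⟨D.isOpen, D.isBounded, hr.1, fun y hy => (D.nu_normal y hy).1,
      fun y hy => ((D.nu_normal y hy).2 r hr).1, fun y hy => ((D.nu_normal y hy).2 r hr).2⟩
  set I := bInt D.carrier (fun y => (fderiv ℝ g y (rot (D.nu y)))^2)
  have hpos := H.integral_pos hφc (fun y => (hφ01 y).1) hz hφz
  set P := bInt D.carrier φ with hP
  have one : ∀ y ∈ frontier D.carrier, y ∈ ball x₀ ρ → |g y - g x₀| ≤ 2 * 2 ^ 41 * √ρ * √I := by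
    intro y hy hyb
    rw [mem_ball, dist_eq_norm] at hyb
    refine (H.pair hg hx₀ hy (by linarith)).trans ?_
    gcongr
  set M := 2 * (2 * 2 ^ 41) * √ρ * √I with hM
  have two : ∀ y ∈ frontier D.carrier, φ y * |g y - g x| ≤ φ y * M := by
    intro y hy
    rcases eq_or_ne (φ y) 0 with h | h
    · simp [h]
    · refine mul_le_mul_of_nonneg_left ?_ (hφ01 y).1
      have a1 := one y hy (hφs y hy h)
      have a2 := one x hx hxb
      rw [abs_sub_comm] at a2
      have := abs_sub_le (g y) (g x₀) (g x)
      rw [hM]; linarith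
  have hgc : ContinuousOn g (frontier D.carrier) := hg.continuous.continuousOn
  have i1 := H.integrableOn hφc
  have i2 : IntegrableOn (fun y => φ y * g y) (frontier D.carrier) μH[1] :=
    H.integrableOn (hφc.mul hgc)
  have e1 : bInt D.carrier (fun y => φ y * g y) - P * g x =
      bInt D.carrier (fun y => φ y * (g y - g x)) := by
    rw [hP]
    unfold bInt
    rw [← integral_mul_const]
    beta_reduce
    rw [← integral_sub i2 (i1.mul_const _)]
    congr 1; funext y; ring
  have e2 : |bInt D.carrier (fun y => φ y * (g y - g x))| ≤ P * M := by
    rw [hP]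
    unfold bInt
    rw [← integral_mul_const]
    refine (abs_integral_le_integral_abs).trans ?_
    refine setIntegral_mono_on ?_ (i1.mul_const _) isClosed_frontier.measurableSet ?_
    · exact (H.integrableOn (hφc.mul (hgc.sub continuousOn_const))).abs
    · intro y hy
      rw [abs_mul, abs_of_nonneg (hφ01 y).1]
      exact two y hy
  rw [← e1] at e2
  rw [show g x - P⁻¹ * bInt D.carrier (fun y => φ y * g y) =
    - ((bInt D.carrier (fun y => φ y * g y) - P * g x) / P) by field_simp; ring, abs_neg, abs_div,
    abs_of_pos hpos, div_le_iff₀ hpos]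
  linarith

end StokesPaper

end
end

section
/- Let Ω ⊂ ℝ² be a UBC domain and p ∈ [1, ∞). Then for every f ∈ W^{1,p}(Ω): ∫_{∂Ω} |f|^p dH¹ ≤ ∫_Ω ( (2/r_Ω) |f|^p + p |f|^{p−1} |∇f| ) dx, where f on ∂Ω denotes the image of f under the trace operator. -/
open MeasureTheory Metric Set Filter
open scoped RealInnerProductSpace ENNReal Topology NNReal

noncomputable section

namespace StokesPaper

/-- Metric properties of the unit normal field on the boundary. -/
def GoodN (F : Set E2) (r : ℝ) (ν : E2 → E2) : Prop :=
  ∀ x ∈ F, ‖ν x‖ = 1 ∧ ∀ y ∈ F, |⟪y - x, ν x⟫| * (2 * r) ≤ ‖y - x‖ ^ 2 ∧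
    r * ‖ν y - ν x‖ ≤ ‖y - x‖

lemma exists_normal {Ω : Set E2} (hΩ : IsOpen Ω) {r : ℝ} (h : IsUBCWith Ω r) :
    ∃ ν : E2 → E2, Continuous ν ∧ GoodN (frontier Ω) r ν ∧
      ∀ x ∈ frontier Ω, ball (x - r • ν x) r ⊆ Ω := by
  obtain ⟨hr, h⟩ := h
  have h1 : ∀ x : E2, ∃ n : E2, x ∈ frontier Ω →
      ‖n‖ = 1 ∧ ball (x - r • n) r ⊆ Ω ∧ ball (x + r • n) r ⊆ Ωᶜ := by
    intro x
    by_cases hx : x ∈ frontier Ω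
    swap
    · exact ⟨0, fun h => absurd h hx⟩
    obtain ⟨a, b, ha, hb, hab⟩ := h x hx
    have hxm : x ∈ sphere a r ∩ sphere b r := by rw [hab]; rfl
    have hxa : ‖x - a‖ = r := by simpa [dist_eq_norm] using hxm.1
    have hxb : ‖b - x‖ = r := by
      have := hxm.2
      rw [mem_sphere, dist_comm, dist_eq_norm] at this
      exact this
    have hd : Disjoint (ball a r) (ball b r) :=
      Set.disjoint_of_subset ha hb disjoint_compl_right
    rw [disjoint_ball_ball_iff hr hr, dist_comm, dist_eq_norm] at hd
    have hpar := parallelogram_law_with_norm ℝ (x - a) (b - x)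
    have e1 : (x - a) + (b - x) = b - a := by abel
    rw [e1, hxa, hxb] at hpar
    have h0 : ‖(x - a) - (b - x)‖ = 0 := by
      have := norm_nonneg ((x - a) - (b - x))
      nlinarith
    have h0' : x - a = b - x := by rwa [norm_eq_zero, sub_eq_zero] at h0
    refine ⟨r⁻¹ • (x - a), fun _ => ⟨?_, ?_, ?_⟩⟩
    · rw [norm_smul, hxa, Real.norm_eq_abs, abs_inv, abs_of_pos hr, inv_mul_cancel₀ hr.ne']
    · rw [smul_inv_smul₀ hr.ne']
      simpa using ha
    · rw [smul_inv_smul₀ hr.ne', h0']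
      simpa using hb
  choose n hn using h1
  have hgood : GoodN (frontier Ω) r n := by
    intro x hx
    obtain ⟨n1, i1, o1⟩ := hn x hx
    refine ⟨n1, fun y hy => ⟨?_, ?_⟩⟩
    · have hyΩ : y ∉ Ω := fun hyΩ => by
        rw [hΩ.frontier_eq] at hy
        exact hy.2 hyΩ
      have a1 : r ≤ ‖(y - x) + r • n x‖ := by
        by_contra! hlt
        apply hyΩ
        apply i1
        rw [mem_ball, dist_eq_norm]
        rwa [← sub_add]
      have a2 : r ≤ ‖(y - x) - r • n x‖ := by
        by_contra! hlt
        have hyc : y ∈ closure Ω := frontier_subset_closure hy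
        have hyb : y ∈ ball (x + r • n x) r := by
          rw [mem_ball, dist_eq_norm]
          rwa [← sub_sub]
        obtain ⟨z, hz1, hz2⟩ := mem_closure_iff.1 hyc _ isOpen_ball hyb
        exact o1 hz1 hz2
      have b1 := norm_add_sq_real (y - x) (r • n x)
      have b2 := norm_sub_sq_real (y - x) (r • n x)
      rw [real_inner_smul_right, norm_smul, n1, Real.norm_eq_abs, abs_of_pos hr] at b1 b2
      have c1 : r ^ 2 ≤ ‖(y - x) + r • n x‖ ^ 2 := by gcongr
      have c2 : r ^ 2 ≤ ‖(y - x) - r • n x‖ ^ 2 := by gcongr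
      rcases abs_cases (⟪y - x, n x⟫) with ⟨h, _⟩ | ⟨h, _⟩ <;> rw [h] <;> nlinarith
    · obtain ⟨n2, i2, o2⟩ := hn y hy
      have d1 : Disjoint (ball (x - r • n x) r) (ball (y + r • n y) r) :=
        Set.disjoint_of_subset i1 o2 disjoint_compl_right
      have d2 : Disjoint (ball (y - r • n y) r) (ball (x + r • n x) r) :=
        Set.disjoint_of_subset i2 o1 disjoint_compl_right
      rw [disjoint_ball_ball_iff hr hr, dist_comm, dist_eq_norm] at d1
      rw [disjoint_ball_ball_iff hr hr, dist_eq_norm] at d2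
      have e1 : y + r • n y - (x - r • n x) = (y - x) + r • (n y + n x) := by
        rw [smul_add]; abel
      have e2 : y - r • n y - (x + r • n x) = (y - x) - r • (n y + n x) := by
        rw [smul_add]; abel
      rw [e1] at d1
      rw [e2] at d2
      have b1 := norm_add_sq_real (y - x) (r • (n y + n x))
      have b2 := norm_sub_sq_real (y - x) (r • (n y + n x))
      have c1 : (r + r) ^ 2 ≤ ‖(y - x) + r • (n y + n x)‖ ^ 2 := by gcongr
      have c2 : (r + r) ^ 2 ≤ ‖(y - x) - r • (n y + n x)‖ ^ 2 := by gcongr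
      rw [norm_smul, Real.norm_eq_abs, abs_of_pos hr] at b1 b2
      have hpar := parallelogram_law_with_norm ℝ (n y) (n x)
      rw [n1, n2] at hpar
      apply le_of_sq_le_sq _ (norm_nonneg _)
      nlinarith
  have hlip : LipschitzOnWith (Real.toNNReal r⁻¹) n (frontier Ω) := by
    apply LipschitzOnWith.of_dist_le_mul
    intro x hx y hy
    rw [Real.coe_toNNReal _ (by positivity), dist_eq_norm, dist_eq_norm, inv_mul_eq_div,
      le_div_iff₀ hr, mul_comm]
    exact ((hgood y hy).2 x hx).2
  obtain ⟨g, hg, hgn⟩ := hlip.extend_finite_dimension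
  refine ⟨g, hg.continuous, ?_, ?_⟩
  · intro x hx
    rw [← hgn hx]
    refine ⟨(hgood x hx).1, fun y hy => ?_⟩
    rw [← hgn hy]
    exact (hgood x hx).2 y hy
  · intro x hx
    rw [← hgn hx]
    exact (hn x hx).2.1

/-- The tubular map. -/
def tub (ν : E2 → E2) (z : E2 × ℝ) : E2 := z.1 - z.2 • ν z.1

lemma tub_continuous {ν : E2 → E2} (hν : Continuous ν) : Continuous (tub ν) := by
  unfold tub; fun_prop

/-- Basic lower bound. -/
lemma tub_lower {F : Set E2} {r : ℝ} (hr : 0 < r) {ν : E2 → E2} (h : GoodN F r ν)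
    {x y : E2} (hx : x ∈ F) (hy : y ∈ F) {t s : ℝ} (ht : 0 < t) (htr : t < r) :
    (1 - t / r) ^ 2 * ‖x - y‖ ^ 2 + (t - s) ^ 2 - 2 * |t - s| * (‖x - y‖ ^ 2 / r)
      ≤ ‖tub ν (x, t) - tub ν (y, s)‖ ^ 2 := by
  obtain ⟨n1, h1⟩ := h y hy
  obtain ⟨ha, hb⟩ := h1 x hx
  have n2 := (h x hx).1
  have e : tub ν (x, t) - tub ν (y, s) = ((x - y) - t • (ν x - ν y)) - (t - s) • ν y := by
    simp only [tub, smul_sub, sub_smul]; abel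
  have hw : ⟪ν x - ν y, ν y⟫ = - (‖ν x - ν y‖ ^ 2 / 2) := by
    have := norm_sub_sq_real (ν x) (ν y)
    rw [inner_sub_left, real_inner_self_eq_norm_sq, n1]
    rw [n1, n2] at this
    linarith
  rw [e, norm_sub_sq_real (x - y - t • (ν x - ν y)) ((t - s) • ν y), norm_smul, n1, real_inner_smul_right, inner_sub_left,
    real_inner_smul_left, hw, Real.norm_eq_abs, mul_one, sq_abs]
  set u := ‖x - y‖ with hu
  set w := ‖ν x - ν y‖ with hw'
  set i := ⟪x - y, ν y⟫ with hi
  have hu0 : 0 ≤ u := norm_nonneg _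
  have hw0 : 0 ≤ w := norm_nonneg _
  have hwr : w ≤ u / r := by rw [le_div_iff₀ hr]; linarith
  have k1 : (1 - t / r) * u ≤ ‖(x - y) - t • (ν x - ν y)‖ := by
    have := norm_sub_norm_le (x - y) (t • (ν x - ν y))
    rw [norm_smul, Real.norm_eq_abs, abs_of_pos ht, ← hu, ← hw'] at this
    have : t * w ≤ t * (u / r) := by gcongr
    have e : t * (u / r) = t / r * u := by ring
    nlinarith
  have hq : 0 ≤ 1 - t / r := by
    rw [sub_nonneg, div_le_one hr]; exact htr.le
  have k2 : ((1 - t / r) * u) ^ 2 ≤ ‖(x - y) - t • (ν x - ν y)‖ ^ 2 := by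
    gcongr
  have k3 : |i - t * -(w ^ 2 / 2)| ≤ u ^ 2 / r := by
    have m1 : |i| ≤ u ^ 2 / r / 2 := by
      rw [div_div, le_div_iff₀ (by positivity)]; linarith
    have m2 : t * (w ^ 2 / 2) ≤ u ^ 2 / r / 2 := by
      calc t * (w ^ 2 / 2) ≤ r * ((u / r) ^ 2 / 2) := by gcongr
        _ = u ^ 2 / r / 2 := by field_simp
    have m3 : 0 ≤ t * (w ^ 2 / 2) := by positivity
    rw [abs_le] at m1 ⊢
    constructor <;> linarith [m1.1, m1.2]
  have k4 : (t - s) * (i - t * -(w ^ 2 / 2)) ≤ |t - s| * (u ^ 2 / r) := by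
    calc _ ≤ |(t - s) * (i - t * -(w ^ 2 / 2))| := le_abs_self _
      _ ≤ _ := by rw [abs_mul]; gcongr
  nlinarith

lemma tub_injOn {F : Set E2} {r : ℝ} (hr : 0 < r) {ν : E2 → E2} (h : GoodN F r ν) :
    InjOn (tub ν) (F ×ˢ Ioo 0 r) := by
  have key : ∀ x ∈ F, ∀ y ∈ F, ∀ t s : ℝ, 0 < t → t < r → 0 < s →
      tub ν (x, t) = tub ν (y, s) → t ≤ s := by
    intro x hx y hy t s ht htr hs he
    obtain ⟨n1, h1⟩ := h x hx
    obtain ⟨ha, -⟩ := h1 y hy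
    have e1 : (y - x) + r • ν x = s • ν y + (r - t) • ν x := by
      simp only [tub] at he
      rw [sub_eq_sub_iff_add_eq_add] at he
      rw [sub_smul, sub_add_eq_add_sub, sub_eq_iff_eq_add, add_sub_assoc', sub_add_eq_add_sub,
        eq_sub_iff_add_eq]
      rw [add_right_comm, ← he]; abel
    have b1 := norm_add_sq_real (y - x) (r • ν x)
    rw [real_inner_smul_right, norm_smul, n1, Real.norm_eq_abs, abs_of_pos hr, e1] at b1
    have b2 : ‖s • ν y + (r - t) • ν x‖ ≤ s + (r - t) := by
      refine (norm_add_le _ _).trans ?_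
      rw [norm_smul, norm_smul, n1, (h y hy).1, Real.norm_eq_abs, Real.norm_eq_abs,
        abs_of_pos hs, abs_of_pos (by linarith)]
      linarith
    have b3 : r ^ 2 ≤ ‖s • ν y + (r - t) • ν x‖ ^ 2 := by
      have := neg_abs_le (⟪y - x, ν x⟫)
      nlinarith
    have := le_of_sq_le_sq b3 (norm_nonneg _)
    linarith
  rintro ⟨x, t⟩ ⟨hx, ht⟩ ⟨y, s⟩ ⟨hy, hs⟩ he
  have hts : t = s := le_antisymm (key x hx y hy t s ht.1 ht.2 hs.1 he)
    (key y hy x hx s t hs.1 hs.2 ht.1 he.symm)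
  subst hts
  have := tub_lower hr h hx hy (s := t) ht.1 ht.2
  rw [he] at this
  simp only [sub_self, norm_zero, abs_zero] at this
  have hq : 0 < 1 - t / r := by
    rw [sub_pos, div_lt_one hr]; exact ht.2
  have h2 : ‖x - y‖ = 0 := by
    by_contra hne
    have : 0 < (1 - t / r) ^ 2 * ‖x - y‖ ^ 2 := by positivity
    linarith
  rw [norm_eq_zero, sub_eq_zero] at h2
  rw [h2]

lemma haus_comp {Z X Y : Type*} [EMetricSpace X] [MeasurableSpace X] [BorelSpace X]
    [EMetricSpace Y] [MeasurableSpace Y] [BorelSpace Y] (f : Z → X) (g : Z → Y) (S : Set Z)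
    (K : ℝ≥0) (h : ∀ z ∈ S, ∀ w ∈ S, edist (f z) (f w) ≤ K * edist (g z) (g w))
    {d : ℝ} (hd : 0 ≤ d) : μH[d] (f '' S) ≤ (K : ℝ≥0∞) ^ d * μH[d] (g '' S) := by
  rcases S.eq_empty_or_nonempty with rfl | ⟨z0, hz0⟩
  · simp
  have : Nonempty Z := ⟨z0⟩
  have hinv : ∀ z ∈ S, Function.invFunOn g S (g z) ∈ S ∧
      g (Function.invFunOn g S (g z)) = g z := fun z hz =>
    ⟨Function.invFunOn_mem ⟨z, hz, rfl⟩, Function.invFunOn_eq ⟨z, hz, rfl⟩⟩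
  have hl : LipschitzOnWith K (f ∘ Function.invFunOn g S) (g '' S) := by
    rintro _ ⟨z, hz, rfl⟩ _ ⟨w, hw, rfl⟩
    have := h _ (hinv z hz).1 _ (hinv w hw).1
    rwa [(hinv z hz).2, (hinv w hw).2] at this
  have heq : f '' S = (f ∘ Function.invFunOn g S) '' (g '' S) := by
    rw [image_image]
    apply image_congr
    intro z hz
    have := h _ hz _ (hinv z hz).1
    rw [(hinv z hz).2, edist_self, mul_zero, nonpos_iff_eq_zero, edist_eq_zero] at this
    exact this
  rw [heq]
  exact hl.hausdorffMeasure_image_le hd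

lemma vol_comp {Z : Type*} (f : Z → WithLp 2 (ℝ × ℝ)) (g : Z → E2) (S : Set Z)
    (K : ℝ≥0) (h : ∀ z ∈ S, ∀ w ∈ S, edist (f z) (f w) ≤ K * edist (g z) (g w)) :
    volume (f '' S) ≤ (K : ℝ≥0∞) ^ 2 * volume (g '' S) := by
  have e1 : (volume : Measure (WithLp 2 (ℝ × ℝ))) = μHE[2] := by
    rw [← InnerProductSpace.euclideanHausdorffMeasure_eq_volume]
    congr
    rw [(WithLp.linearEquiv 2 ℝ (ℝ × ℝ)).finrank_eq]
    simp
  have e2 : (volume : Measure E2) = μHE[2] :=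
    (EuclideanSpace.euclideanHausdorffMeasure_eq_volume 2).symm
  rw [e1, e2, Measure.euclideanHausdorffMeasure_def, Measure.euclideanHausdorffMeasure_def,
    Measure.smul_apply, Measure.smul_apply, ENNReal.smul_def, ENNReal.smul_def, smul_eq_mul,
    smul_eq_mul, mul_left_comm]
  gcongr
  have := haus_comp f g S K h (d := 2) (by norm_num)
  simpa using this

lemma norm_sq_rot (u n : E2) (hn : ‖n‖ = 1) : ‖u‖ ^ 2 = ⟪u, rot n⟫ ^ 2 + ⟪u, n⟫ ^ 2 := by
  have h1 : n 0 ^ 2 + n 1 ^ 2 = 1 := by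
    have := EuclideanSpace.norm_sq_eq n
    rw [hn] at this
    simpa [Fin.sum_univ_two] using this.symm
  rw [EuclideanSpace.norm_sq_eq]
  simp [rot, e, inner_sub_right, PiLp.inner_apply, Fin.sum_univ_two]
  linear_combination (-(u 0 ^ 2 + u 1 ^ 2)) * h1

lemma local_est {F : Set E2} {r : ℝ} (hr : 0 < r) {ν : E2 → E2} (h : GoodN F r ν)
    {K : ℝ} (hK : 1 < K) {x₀ : E2} (hx₀ : x₀ ∈ F) {t₀ : ℝ} (ht₀ : t₀ < r) :
    ∃ δ > 0, (∀ x ∈ F ∩ ball x₀ δ, ∀ y ∈ F ∩ ball x₀ δ,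
        ‖x - y‖ ≤ K * |⟪x - y, rot (ν x₀)⟫|) ∧
      (∀ x ∈ F ∩ ball x₀ δ, ∀ y ∈ F ∩ ball x₀ δ, ∀ t ∈ Ioo 0 r ∩ ball t₀ δ,
        ∀ s ∈ Ioo 0 r ∩ ball t₀ δ, (1 - t₀ / r) ^ 2 * ‖x - y‖ ^ 2 + (t - s) ^ 2 ≤
          K ^ 2 * ‖tub ν (x, t) - tub ν (y, s)‖ ^ 2) ∧
      (∀ t ∈ ball t₀ δ, 1 - t / r ≤ K * (1 - t₀ / r)) := by
  set a := 1 - t₀ / r with ha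
  have ha0 : 0 < a := by rw [ha, sub_pos, div_lt_one hr]; exact ht₀
  have hK0 : 0 < K := by linarith
  have hK2 : 1 < K ^ 2 := one_lt_pow₀ hK (by norm_num)
  have E1 : ∀ᶠ δ : ℝ in 𝓝[>] 0, K ^ 2 * (2 * δ / r) ^ 2 < K ^ 2 - 1 := by
    apply ((Continuous.tendsto' (by fun_prop) 0 0 (by simp)).mono_left
      nhdsWithin_le_nhds).eventually_lt_const
    linarith
  have E2' : ∀ᶠ δ : ℝ in 𝓝[>] 0, a ^ 2 < K ^ 2 * ((a - δ / r) ^ 2 - 4 * δ / r) := by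
    apply ((Continuous.tendsto' (by fun_prop) 0 (K ^ 2 * a ^ 2) (by simp)).mono_left
      nhdsWithin_le_nhds).eventually_const_lt
    nlinarith [pow_pos ha0 2]
  have E3 : ∀ᶠ δ : ℝ in 𝓝[>] 0, 0 < a - δ / r := by
    apply ((Continuous.tendsto' (by fun_prop) 0 a (by simp)).mono_left
      nhdsWithin_le_nhds).eventually_const_lt ha0
  have E4 : ∀ᶠ δ : ℝ in 𝓝[>] 0, a + δ / r < K * a := by
    apply ((Continuous.tendsto' (by fun_prop) 0 a (by simp)).mono_left
      nhdsWithin_le_nhds).eventually_lt_const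
    nlinarith
  obtain ⟨δ, h1, h2, h3, h4, hδ⟩ :=
    (E1.and (E2'.and (E3.and (E4.and self_mem_nhdsWithin)))).exists
  have hδ0 : 0 < δ := hδ
  have hquo : ∀ t ∈ ball t₀ δ, |(1 - t / r) - a| ≤ δ / r := by
    intro t ht
    rw [mem_ball, Real.dist_eq] at ht
    have : (1 - t / r) - a = - ((t - t₀) / r) := by rw [ha]; ring
    rw [this, abs_neg, abs_div, abs_of_pos hr]
    gcongr
  have hdist : ∀ x ∈ ball x₀ δ, ∀ y ∈ ball x₀ δ, ‖x - y‖ ≤ 2 * δ := by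
    intro x hx y hy
    rw [← dist_eq_norm]
    have := dist_triangle_right x y x₀
    rw [mem_ball] at hx hy
    linarith
  refine ⟨δ, hδ0, ?_, ?_, ?_⟩
  · rintro x ⟨hx, hxb⟩ y ⟨hy, hyb⟩
    have hn := norm_sq_rot (x - y) (ν x₀) (h x₀ hx₀).1
    have b := ((h y hy).2 x hx).1
    have c := ((h x₀ hx₀).2 y hy).2
    have hd := hdist x hxb y hyb
    have hyd : ‖y - x₀‖ ≤ δ := by rw [← dist_eq_norm]; exact (mem_ball.1 hyb).le
    have b1 : |⟪x - y, ν y⟫| ≤ ‖x - y‖ * (δ / r) := by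
      have : ‖x - y‖ * (δ / r) = ‖x - y‖ * (2 * δ) / (2 * r) := by field_simp
      rw [this, le_div_iff₀ (by positivity)]
      refine b.trans ?_
      rw [sq]; gcongr
    have c1 : |⟪x - y, ν y - ν x₀⟫| ≤ ‖x - y‖ * (δ / r) := by
      refine (abs_real_inner_le_norm _ _).trans ?_
      gcongr
      rw [le_div_iff₀ hr]; linarith
    have d1 : |⟪x - y, ν x₀⟫| ≤ ‖x - y‖ * (2 * δ / r) := by
      have e : ⟪x - y, ν x₀⟫ = ⟪x - y, ν y⟫ - ⟪x - y, ν y - ν x₀⟫ := by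
        rw [inner_sub_right]; ring
      rw [e]
      refine (abs_sub _ _).trans ?_
      have : ‖x - y‖ * (2 * δ / r) = ‖x - y‖ * (δ / r) + ‖x - y‖ * (δ / r) := by ring
      linarith
    have d2 : ⟪x - y, ν x₀⟫ ^ 2 ≤ (‖x - y‖ * (2 * δ / r)) ^ 2 := by
      rw [← sq_abs]; gcongr
    apply le_of_sq_le_sq _ (by positivity)
    rw [mul_pow, sq_abs]
    have p0 : 0 ≤ ‖x - y‖ ^ 2 := by positivity
    have p1 : K ^ 2 * ⟪x - y, ν x₀⟫ ^ 2 ≤ ‖x - y‖ ^ 2 * (K ^ 2 * (2 * δ / r) ^ 2) := by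
      calc _ ≤ K ^ 2 * (‖x - y‖ * (2 * δ / r)) ^ 2 := by gcongr
        _ = _ := by ring
    nlinarith [mul_le_mul_of_nonneg_left h1.le p0]
  · rintro x ⟨hx, hxb⟩ y ⟨hy, hyb⟩ t ⟨ht, htb⟩ s ⟨hs, hsb⟩
    have hl := tub_lower hr h hx hy (s := s) ht.1 ht.2
    have hts : |t - s| ≤ 2 * δ := by
      rw [← Real.dist_eq]
      have := dist_triangle_right t s t₀
      rw [mem_ball] at htb hsb
      linarith
    have hq := (abs_le.1 (hquo t htb)).1
    have hq2 : (a - δ / r) ^ 2 ≤ (1 - t / r) ^ 2 := by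
      apply pow_le_pow_left₀ h3.le; linarith
    have p0 : 0 ≤ ‖x - y‖ ^ 2 := by positivity
    have l1 : 2 * |t - s| * (‖x - y‖ ^ 2 / r) ≤ (4 * δ / r) * ‖x - y‖ ^ 2 := by
      calc _ ≤ 2 * (2 * δ) * (‖x - y‖ ^ 2 / r) := by gcongr
        _ = _ := by ring
    have l2 : (a - δ / r) ^ 2 * ‖x - y‖ ^ 2 ≤ (1 - t / r) ^ 2 * ‖x - y‖ ^ 2 := by gcongr
    have l3 : ((a - δ / r) ^ 2 - 4 * δ / r) * ‖x - y‖ ^ 2 + (t - s) ^ 2 ≤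
        ‖tub ν (x, t) - tub ν (y, s)‖ ^ 2 := by linarith
    have l4 : a ^ 2 * ‖x - y‖ ^ 2 ≤
        K ^ 2 * ((a - δ / r) ^ 2 - 4 * δ / r) * ‖x - y‖ ^ 2 := by gcongr
    have l5 : (t - s) ^ 2 ≤ K ^ 2 * (t - s) ^ 2 := by nlinarith [sq_nonneg (t - s)]
    have l6 := mul_le_mul_of_nonneg_left l3 (by positivity : 0 ≤ K ^ 2)
    linarith
  · intro t ht
    have hq := (abs_le.1 (hquo t ht)).2
    linarith

lemma haus_slice {F : Set E2} {K : ℝ} (hK : 0 < K) {τ x₀ : E2} {δ : ℝ}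
    (h : ∀ x ∈ F ∩ ball x₀ δ, ∀ y ∈ F ∩ ball x₀ δ, ‖x - y‖ ≤ K * |⟪x - y, τ⟫|)
    {A : Set E2} (hA : A ⊆ F ∩ ball x₀ δ) {a : ℝ} (ha : 0 < a) :
    ENNReal.ofReal a * μH[1] A ≤ ENNReal.ofReal K * volume ((fun x => a * ⟪x, τ⟫) '' A) := by
  have h1 := haus_comp (fun x : E2 => x) (fun x : E2 => a * ⟪x, τ⟫) A (Real.toNNReal (K / a))
    (by
      intro x hx y hy
      rw [edist_dist, edist_dist, ← ENNReal.ofReal, ← ENNReal.ofReal_mul (by positivity)]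
      apply ENNReal.ofReal_le_ofReal
      rw [dist_eq_norm, Real.dist_eq, ← mul_sub, ← inner_sub_left, abs_mul, abs_of_pos ha,
        ← mul_assoc, div_mul_cancel₀ _ ha.ne']
      exact h x (hA hx) y (hA hy)) (d := 1) (by norm_num)
  rw [image_id', ENNReal.rpow_one, hausdorffMeasure_real] at h1
  calc ENNReal.ofReal a * μH[1] A
      ≤ ENNReal.ofReal a * (ENNReal.ofReal (K / a) * volume ((fun x => a * ⟪x, τ⟫) '' A)) := by
        gcongr; exact h1
    _ = _ := by
        rw [← mul_assoc, ← ENNReal.ofReal_mul ha.le, mul_div_cancel₀ _ ha.ne']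

lemma haus_finite {F : Set E2} (hF : IsCompact F) {r : ℝ} (hr : 0 < r) {ν : E2 → E2}
    (h : GoodN F r ν) : μH[1] F < ⊤ := by
  apply hF.measure_lt_top_of_nhdsWithin
  intro x hx
  obtain ⟨δ, hδ, h1, -, -⟩ := local_est hr h one_lt_two hx hr
  refine ⟨F ∩ ball x δ, inter_mem_nhdsWithin _ (ball_mem_nhds x hδ), ?_⟩
  have h2 := haus_slice two_pos h1 subset_rfl one_pos
  rw [ENNReal.ofReal_one, one_mul] at h2
  refine h2.trans_lt (ENNReal.mul_lt_top ENNReal.ofReal_lt_top ?_)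
  have hc : IsCompact ((fun y : E2 => (1 : ℝ) * ⟪y, rot (ν x)⟫) '' F) :=
    hF.image (by fun_prop)
  exact (measure_mono (image_mono inter_subset_left)).trans_lt hc.measure_lt_top

lemma lintegral_slice_le (T : Set (ℝ × ℝ)) :
    ∫⁻ t, volume ((fun s => (s, t)) ⁻¹' T) ≤ volume T := by
  rw [← measure_toMeasurable T, Measure.volume_eq_prod,
    Measure.prod_apply_symm (measurableSet_toMeasurable _ _)]
  apply lintegral_mono
  intro t
  exact measure_mono (preimage_mono (subset_toMeasurable _ _))

lemma local_meas {F : Set E2} (hF : MeasurableSet F) {r : ℝ} (hr : 0 < r) {ν : E2 → E2}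
    (h : GoodN F r ν) [SFinite ((μH[1] : Measure E2).restrict F)]
    {K : ℝ} (hK : 1 < K) {x₀ : E2} (hx₀ : x₀ ∈ F) {t₀ : ℝ} (ht₀ : t₀ < r) :
    ∃ δ > 0, ∀ S : Set (E2 × ℝ), MeasurableSet S →
      S ⊆ (F ×ˢ Ioo 0 r) ∩ (ball x₀ δ ×ˢ ball t₀ δ) →
      ∫⁻ z in S, ENNReal.ofReal (1 - z.2 / r) ∂(((μH[1] : Measure E2).restrict F).prod volume) ≤
        ENNReal.ofReal K ^ 4 * volume (tub ν '' S) := by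
  obtain ⟨δ, hδ, h1, h2, h3⟩ := local_est hr h hK hx₀ ht₀
  refine ⟨δ, hδ, fun S hS hSs => ?_⟩
  set a := 1 - t₀ / r with ha
  have ha0 : 0 < a := by rw [ha, sub_pos, div_lt_one hr]; exact ht₀
  have hK0 : 0 < K := by linarith
  set τ := rot (ν x₀) with hτ
  have hτn : ∀ u : E2, ⟪u, τ⟫ ^ 2 ≤ ‖u‖ ^ 2 := fun u => by
    have := norm_sq_rot u (ν x₀) (h x₀ hx₀).1
    nlinarith [sq_nonneg ⟪u, ν x₀⟫]
  set Q : E2 × ℝ → ℝ × ℝ := fun z => (a * ⟪z.1, τ⟫, z.2) with hQ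
  set μ := (μH[1] : Measure E2).restrict F with hμ
  have s1 : ∫⁻ z in S, ENNReal.ofReal (1 - z.2 / r) ∂(μ.prod volume) ≤
      ENNReal.ofReal (K * a) * (μ.prod volume) S := by
    rw [← setLIntegral_const]
    apply setLIntegral_mono' hS
    intro z hz
    exact ENNReal.ofReal_le_ofReal (h3 _ (hSs hz).2.2)
  have s2 : ENNReal.ofReal a * (μ.prod volume) S ≤ ENNReal.ofReal K * volume (Q '' S) := by
    rw [Measure.prod_apply_symm hS, ← lintegral_const_mul' _ _ ENNReal.ofReal_ne_top]
    refine le_trans ?_ (mul_le_mul_right (lintegral_slice_le (Q '' S)) _)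
    rw [← lintegral_const_mul' _ _ ENNReal.ofReal_ne_top]
    apply lintegral_mono
    intro t
    have hsub : ((fun x => (x, t)) ⁻¹' S) ⊆ F ∩ ball x₀ δ := fun x hx =>
      ⟨(hSs hx).1.1, (hSs hx).2.1⟩
    calc ENNReal.ofReal a * μ ((fun x => (x, t)) ⁻¹' S)
        ≤ ENNReal.ofReal a * μH[1] ((fun x => (x, t)) ⁻¹' S) := by
          exact mul_le_mul_right (Measure.restrict_apply_le _ _) _
      _ ≤ _ := haus_slice hK0 h1 hsub ha0
      _ ≤ _ := by
          refine mul_le_mul_right (measure_mono ?_) _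
          rintro _ ⟨x, hx, rfl⟩
          exact ⟨(x, t), hx, rfl⟩
  have s3 : volume (Q '' S) ≤ ENNReal.ofReal K ^ 2 * volume (tub ν '' S) := by
    have e1 := (WithLp.volume_preserving_symm_measurableEquiv_toLp_prod ℝ ℝ).measure_preimage_equiv
      (Q '' S)
    have e2 : (MeasurableEquiv.toLp 2 (ℝ × ℝ)).symm ⁻¹' (Q '' S) =
        (fun z => WithLp.toLp 2 (Q z)) '' S := by
      rw [← MeasurableEquiv.image_eq_preimage_symm, image_image]
      rfl
    rw [← e1, e2]
    apply vol_comp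
    intro z hz w hw
    rw [edist_dist, edist_dist, ← ENNReal.ofReal, ← ENNReal.ofReal_mul hK0.le]
    apply ENNReal.ofReal_le_ofReal
    apply le_of_sq_le_sq _ (by positivity)
    have hz' := hSs hz
    have hw' := hSs hw
    have := h2 z.1 ⟨hz'.1.1, hz'.2.1⟩ w.1 ⟨hw'.1.1, hw'.2.1⟩ z.2 ⟨hz'.1.2, hz'.2.2⟩
      w.2 ⟨hw'.1.2, hw'.2.2⟩
    rw [mul_pow, dist_eq_norm, dist_eq_norm, WithLp.prod_norm_sq_eq_of_L2]
    refine le_trans ?_ this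
    simp only [hQ, WithLp.sub_fst, WithLp.sub_snd, Real.norm_eq_abs, sq_abs]
    change (a * ⟪z.1, τ⟫ - a * ⟪w.1, τ⟫) ^ 2 + (z.2 - w.2) ^ 2 ≤ _
    rw [← mul_sub, ← inner_sub_left, mul_pow]
    exact add_le_add (mul_le_mul_of_nonneg_left (hτn _) (sq_nonneg a)) le_rfl
  calc _ ≤ _ := s1
    _ = ENNReal.ofReal K * (ENNReal.ofReal a * (μ.prod volume) S) := by
        rw [ENNReal.ofReal_mul hK0.le, mul_assoc]
    _ ≤ ENNReal.ofReal K * (ENNReal.ofReal K * (ENNReal.ofReal K ^ 2 *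
          volume (tub ν '' S))) := by
        exact mul_le_mul_right (s2.trans (mul_le_mul_right s3 _)) _
    _ = _ := by ring

lemma global_meas_K {F : Set E2} (hF : MeasurableSet F) {r : ℝ} (hr : 0 < r) {ν : E2 → E2}
    (hν : Continuous ν)
    (h : GoodN F r ν) [SFinite ((μH[1] : Measure E2).restrict F)]
    {K : ℝ} (hK : 1 < K) {S : Set (E2 × ℝ)} (hS : MeasurableSet S) (hSs : S ⊆ F ×ˢ Ioo 0 r) :
    ∫⁻ z in S, ENNReal.ofReal (1 - z.2 / r) ∂(((μH[1] : Measure E2).restrict F).prod volume) ≤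
        ENNReal.ofReal K ^ 4 * volume (tub ν '' S) := by
  have hl : ∀ z : E2 × ℝ, ∃ δ > 0, z ∈ S → ∀ S' : Set (E2 × ℝ), MeasurableSet S' →
      S' ⊆ (F ×ˢ Ioo 0 r) ∩ (ball z.1 δ ×ˢ ball z.2 δ) →
      ∫⁻ z in S', ENNReal.ofReal (1 - z.2 / r) ∂(((μH[1] : Measure E2).restrict F).prod volume) ≤
        ENNReal.ofReal K ^ 4 * volume (tub ν '' S') := by
    intro z
    by_cases hz : z ∈ S
    · obtain ⟨δ, hδ, h1⟩ := local_meas hF hr h hK (hSs hz).1 (hSs hz).2.2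
      exact ⟨δ, hδ, fun _ => h1⟩
    · exact ⟨1, one_pos, fun h => absurd h hz⟩
  choose δ hδ hl using hl
  rcases S.eq_empty_or_nonempty with rfl | hne
  · simp
  obtain ⟨T, hTS, hTc, hTcov⟩ := TopologicalSpace.countable_cover_nhdsWithin (s := S)
    (f := fun z => ball z.1 (δ z) ×ˢ ball z.2 (δ z)) (fun z _ => mem_nhdsWithin_of_mem_nhds
      (prod_mem_nhds (ball_mem_nhds _ (hδ z)) (ball_mem_nhds _ (hδ z))))
  have hTne : T.Nonempty := by
    obtain ⟨z, hz⟩ := hne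
    obtain ⟨w, hw⟩ := mem_iUnion.1 (hTcov hz)
    obtain ⟨hw, -⟩ := mem_iUnion.1 hw
    exact ⟨w, hw⟩
  obtain ⟨c, hc⟩ := hTc.exists_eq_range hTne
  set B : ℕ → Set (E2 × ℝ) := fun n => ball (c n).1 (δ (c n)) ×ˢ ball (c n).2 (δ (c n)) with hB
  have hBm : ∀ n, MeasurableSet (B n) := fun n => measurableSet_ball.prod measurableSet_ball
  set A : ℕ → Set (E2 × ℝ) := fun n => S ∩ disjointed B n with hA
  have hAm : ∀ n, MeasurableSet (A n) := fun n => hS.inter (MeasurableSet.disjointed hBm n)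
  have hAS : S = ⋃ n, A n := by
    rw [hA, ← inter_iUnion, iUnion_disjointed, eq_comm, inter_eq_left]
    intro z hz
    obtain ⟨w, hw⟩ := mem_iUnion.1 (hTcov hz)
    obtain ⟨hw, hzw⟩ := mem_iUnion.1 hw
    rw [hc] at hw
    obtain ⟨n, rfl⟩ := hw
    exact mem_iUnion.2 ⟨n, hzw⟩
  have hAd : Pairwise (Function.onFun Disjoint A) := fun i j hij =>
    (disjoint_disjointed B hij).mono inter_subset_right inter_subset_right
  have hinj := tub_injOn hr h
  have hest : ∀ n, ∫⁻ z in A n, ENNReal.ofReal (1 - z.2 / r)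
      ∂(((μH[1] : Measure E2).restrict F).prod volume) ≤
        ENNReal.ofReal K ^ 4 * volume (tub ν '' A n) := fun n =>
    hl (c n) (hTS (hc ▸ mem_range_self n)) (A n) (hAm n)
      (fun z hz => ⟨hSs hz.1, disjointed_subset B n hz.2⟩)
  have hAsub : ∀ n, A n ⊆ F ×ˢ Ioo 0 r := fun n => inter_subset_left.trans hSs
  calc _ = ∑' n, ∫⁻ z in A n, ENNReal.ofReal (1 - z.2 / r)
      ∂(((μH[1] : Measure E2).restrict F).prod volume) := by
        conv_lhs => rw [hAS]
        exact lintegral_iUnion hAm hAd _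
    _ ≤ ∑' n, ENNReal.ofReal K ^ 4 * volume (tub ν '' A n) := ENNReal.tsum_le_tsum hest
    _ = ENNReal.ofReal K ^ 4 * volume (⋃ n, tub ν '' A n) := by
        rw [ENNReal.tsum_mul_left, measure_iUnion]
        · intro i j hij
          change Disjoint (tub ν '' A i) (tub ν '' A j)
          rw [Set.disjoint_left]
          rintro _ ⟨z, hz, rfl⟩ ⟨w, hw, hwz⟩
          have hzw := hinj (hAsub j hw) (hAsub i hz) hwz
          subst hzw
          exact Set.disjoint_left.1 (hAd hij) hz hw
        · intro n
          exact (hAm n).image_of_continuousOn_injOn (tub_continuous hν).continuousOn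
            (hinj.mono (hAsub n))
    _ = _ := by rw [← image_iUnion, ← hAS]

lemma global_meas {F : Set E2} (hF : MeasurableSet F) {r : ℝ} (hr : 0 < r) {ν : E2 → E2}
    (hν : Continuous ν)
    (h : GoodN F r ν) [SFinite ((μH[1] : Measure E2).restrict F)]
    {S : Set (E2 × ℝ)} (hS : MeasurableSet S) (hSs : S ⊆ F ×ˢ Ioo 0 r) :
    ∫⁻ z in S, ENNReal.ofReal (1 - z.2 / r) ∂(((μH[1] : Measure E2).restrict F).prod volume) ≤
        volume (tub ν '' S) := by
  by_cases ht : volume (tub ν '' S) = ⊤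
  · rw [ht]; exact le_top
  have hlim : Tendsto (fun K : ℝ => ENNReal.ofReal K ^ 4 * volume (tub ν '' S)) (𝓝[>] 1)
      (𝓝 (volume (tub ν '' S))) := by
    have h1 : Tendsto (fun K : ℝ => ENNReal.ofReal (K ^ 4)) (𝓝[>] 1) (𝓝 1) := by
      have : Tendsto (fun K : ℝ => K ^ 4) (𝓝[>] 1) (𝓝 1) :=
        (Continuous.tendsto' (by fun_prop) 1 1 (by simp)).mono_left nhdsWithin_le_nhds
      simpa using ENNReal.tendsto_ofReal this
    have h2 := ENNReal.Tendsto.mul_const h1 (b := volume (tub ν '' S)) (Or.inr ht)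
    rw [one_mul] at h2
    refine h2.congr' ?_
    filter_upwards [self_mem_nhdsWithin] with K hK
    rw [ENNReal.ofReal_pow (by linarith [mem_Ioi.1 hK])]
  refine ge_of_tendsto hlim ?_
  filter_upwards [self_mem_nhdsWithin] with K hK
  exact global_meas_K hF hr hν h hK hS hSs

lemma global_lintegral {Ω : Set E2} {r : ℝ} (hr : 0 < r) {ν : E2 → E2}
    (hν : Continuous ν) (h : GoodN (frontier Ω) r ν)
    (hb : ∀ x ∈ frontier Ω, ball (x - r • ν x) r ⊆ Ω)
    [SFinite ((μH[1] : Measure E2).restrict (frontier Ω))]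
    {g : E2 → ℝ≥0∞} (hg : Measurable g) :
    ∫⁻ x in frontier Ω, (∫⁻ t in Ioo 0 r, ENNReal.ofReal (1 - t / r) * g (tub ν (x, t))) ∂μH[1] ≤
      ∫⁻ y in Ω, g y := by
  set μ := (μH[1] : Measure E2).restrict (frontier Ω) with hμ
  set G : Set (E2 × ℝ) := frontier Ω ×ˢ Ioo 0 r with hG
  have hFm : MeasurableSet (frontier Ω) := isClosed_frontier.measurableSet
  have hGm : MeasurableSet G := hFm.prod measurableSet_Ioo
  have htub := (tub_continuous hν).measurable
  set w : E2 × ℝ → ℝ≥0∞ := fun z => ENNReal.ofReal (1 - z.2 / r) with hw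
  have hwm : Measurable w := by fun_prop
  set m := (((μ.prod volume).restrict G).withDensity w).map (tub ν) with hm
  have hmle : m ≤ volume.restrict Ω := by
    rw [Measure.le_iff]
    intro U hU
    rw [hm, Measure.map_apply htub hU, withDensity_apply _ (htub hU),
      Measure.restrict_restrict (htub hU), Measure.restrict_apply hU]
    refine (global_meas hFm hr hν h ((htub hU).inter hGm) inter_subset_right).trans ?_
    apply measure_mono
    rintro _ ⟨⟨x, t⟩, ⟨hzU, hx, ht⟩, rfl⟩
    refine ⟨hzU, hb x hx ?_⟩
    have e : tub ν (x, t) - (x - r • ν x) = (r - t) • ν x := by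
      simp only [tub, sub_smul]; abel
    rw [mem_ball, dist_eq_norm, e, norm_smul, (h x hx).1, Real.norm_eq_abs,
      abs_of_pos (by linarith [ht.2])]
    linarith [ht.1]
  calc _ = ∫⁻ z in G, w z * g (tub ν z) ∂(μ.prod volume) := by
        have e1 : (μ.prod volume).restrict G = μ.prod (volume.restrict (Ioo 0 r)) := by
          rw [hG, ← Measure.prod_restrict, hμ, Measure.restrict_restrict hFm, inter_self]
        rw [e1, lintegral_prod _ (by fun_prop)]
    _ = ∫⁻ y, g y ∂m := by
        rw [hm, lintegral_map hg htub]
        exact (lintegral_withDensity_eq_lintegral_mul _ hwm (hg.comp htub)).symm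
    _ ≤ _ := lintegral_mono' hmle le_rfl

lemma right_deriv {u : ℝ → ℝ} {u' t p : ℝ} (hp : 1 ≤ p) (hu : HasDerivAt u u' t) :
    ∃ d, HasDerivWithinAt (fun s => |u s| ^ p) d (Ioi t) t ∧
      |d| ≤ p * |u t| ^ (p - 1) * |u'| := by
  rcases hp.eq_or_lt with rfl | hp
  · simp only [Real.rpow_one, sub_self, Real.rpow_zero, mul_one, one_mul]
    by_cases h0 : u t = 0
    · refine ⟨|u'|, ?_, by simp⟩
      rw [hasDerivWithinAt_iff_tendsto_slope' (by simp)]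
      have h1 := hu.hasDerivWithinAt (s := Ioi t)
      rw [hasDerivWithinAt_iff_tendsto_slope' (by simp)] at h1
      refine h1.abs.congr' ?_
      filter_upwards [self_mem_nhdsWithin] with s hs
      have : 0 < s - t := sub_pos.2 hs
      rw [slope_def_field, slope_def_field, h0, abs_zero, sub_zero, sub_zero, abs_div,
        abs_of_pos this]
    · have h1 := hasDerivAt_abs h0
      have h2 := HasDerivAt.comp t h1 hu
      refine ⟨_, h2.hasDerivWithinAt, ?_⟩
      rcases lt_or_gt_of_ne h0 with h | h
      · simp [sign_neg h]
      · simp [sign_pos h]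
  · have h1 := hasDerivAt_abs_rpow (u t) hp
    have h2 := HasDerivAt.comp t h1 hu
    refine ⟨_, h2.hasDerivWithinAt, ?_⟩
    rw [abs_mul, abs_mul, abs_mul, abs_of_pos (by linarith : 0 < p),
      abs_of_nonneg (by positivity : 0 ≤ |u t| ^ (p - 2)), mul_assoc p]
    gcongr
    by_cases h0 : u t = 0
    · rw [h0, abs_zero, mul_zero]; positivity
    · have e1 : p - 1 = (p - 2) + 1 := by ring
      rw [e1, Real.rpow_add (abs_pos.2 h0), Real.rpow_one]

lemma ray_est {u u' H : ℝ → ℝ} {r p : ℝ} (hr : 0 < r) (hp : 1 ≤ p)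
    (hc : ContinuousOn u (Icc 0 r)) (hd : ∀ t ∈ Ioo 0 r, HasDerivAt u (u' t) t)
    (hH : ∀ t ∈ Ioo 0 r, 2 / r * |u t| ^ p + p * |u t| ^ (p - 1) * |u' t| ≤ H t)
    (hm : AEMeasurable H (volume.restrict (Ioo 0 r))) :
    ENNReal.ofReal (|u 0| ^ p) ≤
      ∫⁻ t in Ioo 0 r, ENNReal.ofReal (1 - t / r) * ENNReal.ofReal (H t) := by
  have hq : ∀ t ∈ Ioo 0 r, 0 < 1 - t / r ∧ 1 - t / r ≤ 1 := by
    intro t ht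
    constructor
    · rw [sub_pos, div_lt_one hr]; exact ht.2
    · have := div_pos ht.1 hr
      linarith
  have e1 : ∫⁻ t in Ioo 0 r, ENNReal.ofReal (1 - t / r) * ENNReal.ofReal (H t) =
      ∫⁻ t in Ioo 0 r, ENNReal.ofReal ((1 - t / r) * H t) := by
    apply setLIntegral_congr_fun measurableSet_Ioo
    intro t ht
    exact (ENNReal.ofReal_mul (hq t ht).1.le).symm
  rw [e1]
  by_cases htop : ∫⁻ t in Ioo 0 r, ENNReal.ofReal ((1 - t / r) * H t) = ⊤
  · rw [htop]; exact le_top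
  have hpos : ∀ t ∈ Ioo 0 r, 0 ≤ (1 - t / r) * H t := by
    intro t ht
    apply mul_nonneg (hq t ht).1.le
    refine le_trans ?_ (hH t ht)
    positivity
  have hpos' : 0 ≤ᵐ[volume.restrict (Ioo 0 r)] fun t => (1 - t / r) * H t :=
    (ae_restrict_iff' measurableSet_Ioo).2 (Eventually.of_forall hpos)
  have hmeas : AEStronglyMeasurable (fun t => (1 - t / r) * H t)
      (volume.restrict (Ioo 0 r)) := by
    apply AEMeasurable.aestronglyMeasurable
    exact (by fun_prop : Measurable fun t : ℝ => 1 - t / r).aemeasurable.mul hm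
  have hintegrable : IntegrableOn (fun t => (1 - t / r) * H t) (Ioo 0 r) := by
    refine ⟨hmeas, ?_⟩
    rw [hasFiniteIntegral_iff_ofReal hpos']
    exact lt_top_iff_ne_top.2 htop
  have hrd : ∀ t ∈ Ioo 0 r, ∃ d, HasDerivWithinAt (fun s => |u s| ^ p) d (Ioi t) t ∧
      |d| ≤ p * |u t| ^ (p - 1) * |u' t| := fun t ht => right_deriv hp (hd t ht)
  choose! d hd1 hd2 using hrd
  have main := intervalIntegral.sub_le_integral_of_hasDeriv_right_of_le (a := 0) (b := r)
    (g := fun t => -((1 - t / r) ^ 2 * |u t| ^ p))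
    (g' := fun t => -((2 * (1 - t / r) ^ 1 * (-(1 / r))) * |u t| ^ p + (1 - t / r) ^ 2 * d t))
    (φ := fun t => (1 - t / r) * H t) hr.le
    (by
      apply ContinuousOn.neg
      apply ContinuousOn.mul (by fun_prop)
      exact hc.abs.rpow_const (fun t _ => Or.inr (by linarith)))
    (by
      intro t ht
      apply HasDerivWithinAt.neg
      apply HasDerivWithinAt.mul _ (hd1 t ht)
      have h1 : HasDerivAt (fun t : ℝ => 1 - t / r) (-(1 / r)) t := by
        simpa using ((hasDerivAt_id t).div_const r).const_sub 1
      exact_mod_cast (h1.pow 2).hasDerivWithinAt)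
    (by rw [integrableOn_Icc_iff_integrableOn_Ioo]; exact hintegrable)
    (by
      intro t ht
      obtain ⟨q0, q1⟩ := hq t ht
      have a1 := hH t ht
      have a2 := hd2 t ht
      have a3 := neg_abs_le (d t)
      set q := 1 - t / r
      have b1 : -(q * d t) ≤ p * |u t| ^ (p - 1) * |u' t| := by
        have : 0 ≤ |d t| := abs_nonneg _
        nlinarith
      have b2 : q * (2 / r * |u t| ^ p - q * d t) ≤ q * H t := by
        gcongr; linarith
      have e : -(2 * q ^ 1 * (-(1 / r)) * |u t| ^ p + q ^ 2 * d t) =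
          q * (2 / r * |u t| ^ p - q * d t) := by ring
      rw [e]; exact b2)
  rw [intervalIntegral.integral_of_le hr.le, integral_Ioc_eq_integral_Ioo] at main
  rw [← ofReal_integral_eq_lintegral_ofReal hintegrable hpos']
  apply ENNReal.ofReal_le_ofReal
  simpa [div_self hr.ne'] using main

lemma trace_r {Ω : Set E2} (hΩ : IsOpen Ω) (hbd : Bornology.IsBounded Ω) {r : ℝ}
    (hr : IsUBCWith Ω r) {p : ℝ} (hp : 1 ≤ p) {f : E2 → ℝ} (hf : DifferentiableOn ℝ f Ω)
    (hfc : ContinuousOn f (closure Ω)) (h1 : IntegrableOn (fun x => |f x| ^ p) Ω)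
    (h2 : IntegrableOn (fun x => |f x| ^ (p - 1) * ‖fderiv ℝ f x‖) Ω) :
    bInt Ω (fun x => |f x| ^ p) ≤ 2 / r * (∫ x in Ω, |f x| ^ p) +
      p * ∫ x in Ω, |f x| ^ (p - 1) * ‖fderiv ℝ f x‖ := by
  obtain ⟨ν, hν, hgood, hball⟩ := exists_normal hΩ hr
  have hr0 : 0 < r := hr.1
  have hcomp : IsCompact (frontier Ω) :=
    Metric.isCompact_of_isClosed_isBounded isClosed_frontier
      (hbd.closure.subset frontier_subset_closure)
  have : IsFiniteMeasure ((μH[1] : Measure E2).restrict (frontier Ω)) :=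
    ⟨by rw [Measure.restrict_apply_univ]; exact haus_finite hcomp hr0 hgood⟩
  set H : E2 → ℝ := fun y => 2 / r * |f y| ^ p + p * (|f y| ^ (p - 1) * ‖fderiv ℝ f y‖) with hH
  have hHintegrable : IntegrableOn H Ω := (h1.const_mul (2 / r)).add (h2.const_mul p)
  have hHpos : ∀ y, 0 ≤ H y := fun y => by
    have : 0 < p := by linarith
    simp only [hH]; positivity
  have hHm : Measurable (Ω.indicator H) := by
    have hfm : Measurable (Ω.indicator f) := by
      classical
      have := (hf.continuousOn).measurable_piecewise
        (continuousOn_const (c := (0 : ℝ)) (s := Ωᶜ)) hΩ.measurableSet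
      rw [← Set.piecewise_eq_indicator]
      exact this
    have hdm : Measurable (fderiv ℝ f) := measurable_fderiv ℝ f
    have e : Ω.indicator H = Ω.indicator (fun y => 2 / r * |Ω.indicator f y| ^ p +
        p * (|Ω.indicator f y| ^ (p - 1) * ‖fderiv ℝ f y‖)) := by
      apply Set.indicator_congr
      intro y hy
      simp only [hH, indicator_of_mem hy]
    rw [e]
    apply Measurable.indicator _ hΩ.measurableSet
    fun_prop
  have hgm : Measurable (fun y => ENNReal.ofReal (Ω.indicator H y)) := hHm.ennreal_ofReal
  have key := global_lintegral hr0 hν hgood hball hgm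
  have hray : ∀ x ∈ frontier Ω, ENNReal.ofReal (|f x| ^ p) ≤ ∫⁻ t in Ioo 0 r,
      ENNReal.ofReal (1 - t / r) * ENNReal.ofReal (Ω.indicator H (tub ν (x, t))) := by
    intro x hx
    have hn := (hgood x hx).1
    have hin : ∀ t, 0 < t → t ≤ r → tub ν (x, t) ∈ Ω := by
      intro t ht htr
      apply hball x hx
      have e : tub ν (x, t) - (x - r • ν x) = (r - t) • ν x := by
        simp only [tub, sub_smul]; abel
      rw [mem_ball, dist_eq_norm, e, norm_smul, hn, Real.norm_eq_abs,
        abs_of_nonneg (by linarith)]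
      linarith
    have htc : Continuous fun t : ℝ => tub ν (x, t) :=
      (tub_continuous hν).comp (by fun_prop)
    have := ray_est (u := fun t => f (tub ν (x, t)))
      (u' := fun t => fderiv ℝ f (tub ν (x, t)) (-ν x))
      (H := fun t => Ω.indicator H (tub ν (x, t))) hr0 hp
      (by
        apply hfc.comp htc.continuousOn
        intro t ht
        rcases ht.1.eq_or_lt with rfl | h0
        · simpa [tub] using frontier_subset_closure hx
        · exact subset_closure (hin t h0 ht.2))
      (by
        intro t ht
        have hda : DifferentiableAt ℝ f (tub ν (x, t)) :=
          hf.differentiableAt (hΩ.mem_nhds (hin t ht.1 ht.2.le))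
        have ht' : HasDerivAt (fun t : ℝ => tub ν (x, t)) (-ν x) t := by
          simpa [tub] using ((hasDerivAt_id t).smul_const (ν x)).const_sub x
        exact hda.hasFDerivAt.comp_hasDerivAt t ht')
      (by
        intro t ht
        rw [indicator_of_mem (hin t ht.1 ht.2.le)]
        simp only [hH]
        rw [mul_assoc p]
        have hle : |fderiv ℝ f (tub ν (x, t)) (-ν x)| ≤ ‖fderiv ℝ f (tub ν (x, t))‖ := by
          have := (fderiv ℝ f (tub ν (x, t))).le_opNorm (-ν x)
          rwa [norm_neg, hn, mul_one] at this
        gcongr)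
      (hHm.comp htc.measurable).aemeasurable
    simpa [tub] using this
  have hlin : ∫⁻ x in frontier Ω, ENNReal.ofReal (|f x| ^ p) ∂μH[1] ≤
      ENNReal.ofReal (∫ y in Ω, H y) := by
    calc _ ≤ _ := setLIntegral_mono' isClosed_frontier.measurableSet hray
      _ ≤ _ := key
      _ = ∫⁻ y in Ω, ENNReal.ofReal (H y) := by
          apply setLIntegral_congr_fun hΩ.measurableSet
          intro y hy
          simp only [indicator_of_mem hy]
      _ = _ := (ofReal_integral_eq_lintegral_ofReal hHintegrable
          (Eventually.of_forall hHpos)).symm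
  have hfin : ∫ y in Ω, H y = 2 / r * (∫ x in Ω, |f x| ^ p) +
      p * ∫ x in Ω, |f x| ^ (p - 1) * ‖fderiv ℝ f x‖ := by
    rw [hH, integral_add (h1.const_mul (2 / r)) (h2.const_mul p), integral_const_mul,
      integral_const_mul]
  rw [← hfin]
  unfold bInt
  have hI0 : 0 ≤ ∫ y in Ω, H y := integral_nonneg hHpos
  rw [integral_eq_lintegral_of_nonneg_ae (Eventually.of_forall fun x => by positivity)]
  · exact ENNReal.toReal_le_of_le_ofReal hI0 hlin
  · apply ContinuousOn.aestronglyMeasurable _ isClosed_frontier.measurableSet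
    exact (hfc.mono frontier_subset_closure).abs.rpow_const
      (fun t _ => Or.inr (by linarith))

lemma ubc_bdd {Ω : Set E2} (h : IsUBCDomain Ω) : BddAbove {r : ℝ | IsUBCWith Ω r} := by
  obtain ⟨ho, hc, hb, -⟩ := h
  obtain ⟨x, hx⟩ : (frontier Ω).Nonempty := by
    by_contra hne
    rw [not_nonempty_iff_eq_empty] at hne
    have hcl : IsClopen Ω := isClopen_iff_frontier_eq_empty.2 hne
    rcases isClopen_iff.1 hcl with h | h
    · exact hc.nonempty.ne_empty h
    · rw [h] at hb
      exact NormedSpace.unbounded_univ ℝ E2 hb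
  refine ⟨Metric.diam Ω, ?_⟩
  rintro r ⟨hr, h⟩
  obtain ⟨a, b, ha, -, -⟩ := h x hx
  have h1 : Metric.diam (ball a r) ≤ Metric.diam Ω := Metric.diam_mono ha hb
  rw [Metric.diam_ball_eq a hr.le] at h1
  linarith

/-- Lemma B.1, quantified trace theorem: for a UBC domain and
`p ∈ [1, ∞)`, every `f ∈ W^{1,p}(Ω)` satisfies
`∫_{∂Ω} |f|^p dH¹ ≤ ∫_Ω ((2/r_Ω)|f|^p + p|f|^{p-1}|∇f|) dx`. -/
theorem quantified_trace :
    ∀ Ω : Set E2, IsUBCDomain Ω → ∀ p : ℝ, 1 ≤ p →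
      ∀ f : E2 → ℝ, DifferentiableOn ℝ f Ω → ContinuousOn f (closure Ω) →
        IntegrableOn (fun x => |f x| ^ p) Ω →
        IntegrableOn (fun x => |f x| ^ (p - 1) * ‖fderiv ℝ f x‖) Ω →
        bInt Ω (fun x => |f x| ^ p) ≤
          ∫ x in Ω, ((2 / ubcRadius Ω) * |f x| ^ p +
            p * |f x| ^ (p - 1) * ‖fderiv ℝ f x‖) := by
  intro Ω hΩ p hp f hf hfc h1 h2
  have hbdd := ubc_bdd hΩ
  obtain ⟨ho, hc, hb, r₀, hr₀⟩ := hΩ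
  have hne : {r : ℝ | IsUBCWith Ω r}.Nonempty := ⟨r₀, hr₀⟩
  have hR : 0 < ubcRadius Ω := hr₀.1.trans_le (le_csSup hbdd hr₀)
  have e1 : ∫ x in Ω, ((2 / ubcRadius Ω) * |f x| ^ p +
            p * |f x| ^ (p - 1) * ‖fderiv ℝ f x‖) = 2 / ubcRadius Ω * (∫ x in Ω, |f x| ^ p) +
      p * ∫ x in Ω, |f x| ^ (p - 1) * ‖fderiv ℝ f x‖ := by
    simp only [mul_assoc p]
    rw [integral_add (h1.const_mul _) (h2.const_mul p), integral_const_mul,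
      integral_const_mul]
  rw [e1]
  obtain ⟨s, -, hs, hsm⟩ := exists_seq_tendsto_sSup hne hbdd
  have hlim : Tendsto (fun n => 2 / s n * (∫ x in Ω, |f x| ^ p) +
      p * ∫ x in Ω, |f x| ^ (p - 1) * ‖fderiv ℝ f x‖) atTop
      (𝓝 (2 / ubcRadius Ω * (∫ x in Ω, |f x| ^ p) +
      p * ∫ x in Ω, |f x| ^ (p - 1) * ‖fderiv ℝ f x‖)) :=
    ((tendsto_const_nhds.div hs hR.ne').mul_const _).add_const _
  exact ge_of_tendsto' hlim fun n => trace_r ho hb (hsm n) hp hf hfc h1 h2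

end StokesPaper

end
end
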